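/- arXiv:2605.30037 — 2 statements merged into one kernel-verified Lean document; each statement's English description precedes it below -/
import Mathlib

section
/- For every α > −1, all k, k', n, n' ∈ ℕ₀ and all 1 ≤ l ≤ 2n+1, 1 ≤ l' ≤ 2n'+1, the ball polynomials are mutually orthogonal on the unit ball with respect to the weight ω_α(x) = (1−‖x‖²)^α: ∫_{B³} B_{k,l}^{α,n}(x) B_{k',l'}^{α,n'}(x) (1−‖x‖²)^α dx = h_k^{α,n} δ_{kk'} δ_{ll'} δ_{nn'}, where h_k^{α,n} = Γ(k+α+1) Γ(n+2k+3/2) (n+k+3/2)_k / (2 Γ(k+1) Γ(n+2k+α+5/2) (n+k+α+3/2)_k) and δ denotes the Kronecker delta. -/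
open MeasureTheory Real
open scoped RealInnerProductSpace

noncomputable section

/-- Jacobi polynomial `P_n^{α,β}(t)`. -/
def jacobiP (n : ℕ) (α β : ℝ) (t : ℝ) : ℝ :=
  (Real.Gamma (α + n + 1) / (n.factorial * Real.Gamma (α + β + n + 1))) *
    ∑ m ∈ Finset.range (n + 1), (n.choose m : ℝ) *
      (Real.Gamma (α + β + n + m + 1) / Real.Gamma (α + m + 1)) * ((t - 1) / 2) ^ m

/-- Normalization constant `C_{n,j}` of spherical harmonics. -/
def sphC (n j : ℕ) : ℝ :=
  (1 / 2 ^ j) * Real.sqrt ((2 * n + 1) * Real.Gamma ((n : ℝ) - j + 1) *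
    Real.Gamma ((n : ℝ) + j + 1) / (2 * Real.pi * Real.Gamma ((n : ℝ) + 1) ^ 2))

/-- Spherical harmonic `Y_l^n(θ, φ)`; for `l = 2j` the cosine type, for `l = 2j+1 ≥ 3`
the sine type (in both cases `j = l / 2` by natural division). -/
def sphY (n l : ℕ) (θ φ : ℝ) : ℝ :=
  if l = 1 then Real.sqrt ((2 * n + 1) / (4 * Real.pi)) * jacobiP n 0 0 (Real.cos θ)
  else if l % 2 = 0 then
    sphC n (l / 2) * Real.sin θ ^ (l / 2) * Real.cos ((l / 2 : ℕ) * φ) *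
      jacobiP (n - l / 2) (l / 2 : ℕ) (l / 2 : ℕ) (Real.cos θ)
  else
    sphC n (l / 2) * Real.sin θ ^ (l / 2) * Real.sin ((l / 2 : ℕ) * φ) *
      jacobiP (n - l / 2) (l / 2 : ℕ) (l / 2 : ℕ) (Real.cos θ)

abbrev E3 := EuclideanSpace ℝ (Fin 3)

/-- Pochhammer symbol `(a)_k = Γ(a+k)/Γ(a)`. -/
def poch (a : ℝ) (k : ℕ) : ℝ := Real.Gamma (a + k) / Real.Gamma a

/-- The solid spherical harmonic `‖x‖^n Y_l^n(x/‖x‖)`, written using the polar angles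
`θ = arccos(x₃/‖x‖)` and the azimuthal angle `φ = arg(x₁ + i x₂)` of `x/‖x‖`. -/
def solidY (n l : ℕ) (x : E3) : ℝ :=
  ‖x‖ ^ n * sphY n l (Real.arccos (‖x‖⁻¹ * x 2)) (Complex.arg (x 0 + x 1 * Complex.I))

/-- Ball polynomial `B_{k,l}^{α,n}(x)`. -/
def ballB (α : ℝ) (k n l : ℕ) (x : E3) : ℝ :=
  (poch ((n : ℝ) + k + 3 / 2) k / poch ((n : ℝ) + k + α + 3 / 2) k) *
    jacobiP k α ((n : ℝ) + 1 / 2) (2 * ‖x‖ ^ 2 - 1) * solidY n l x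

/-- Normalization constant `h_k^{α,n}`. -/
def hNorm (α : ℝ) (k n : ℕ) : ℝ :=
  Real.Gamma ((k : ℝ) + α + 1) * Real.Gamma ((n : ℝ) + 2 * k + 3 / 2) *
      poch ((n : ℝ) + k + 3 / 2) k /
    (2 * Real.Gamma ((k : ℝ) + 1) * Real.Gamma ((n : ℝ) + 2 * k + α + 5 / 2) *
      poch ((n : ℝ) + k + α + 3 / 2) k)

end

open Finset in
theorem sum_alternating_choose_succ (n : ℕ) (f : ℕ → ℝ) :
    ∑ m ∈ range (n + 2), (-1) ^ m * ((n + 1).choose m : ℝ) * f m =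
      ∑ m ∈ range (n + 1), (-1) ^ m * (n.choose m : ℝ) * f m -
        ∑ m ∈ range (n + 1), (-1) ^ m * (n.choose m : ℝ) * f (m + 1) := by
  rw [sum_range_succ' _ (n + 1), sum_range_succ' (fun m => (-1) ^ m * (n.choose m : ℝ) * f m) n]
  have h : ∑ m ∈ range n, (-1 : ℝ) ^ (m + 1) * (n.choose (m + 1) : ℝ) * f (m + 1) =
      ∑ m ∈ range (n + 1), (-1 : ℝ) ^ (m + 1) * (n.choose (m + 1) : ℝ) * f (m + 1) := by
    simp [sum_range_succ]
  rw [h]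
  simp only [Nat.choose_succ_succ, Nat.choose_zero_right]
  rw [eq_sub_iff_add_eq, add_right_comm, ← sum_add_distrib]
  congr 1
  refine sum_congr rfl fun m _ => ?_
  push_cast
  ring

open Finset in
theorem sum_alternating_choose_Gamma_div (n : ℕ) {p q : ℝ} (hp : 0 < p) (hq : 0 < q) :
    ∑ m ∈ range (n + 1), (-1) ^ m * (n.choose m : ℝ) * (Gamma (p + m) / Gamma (q + m)) =
      (∏ i ∈ range n, (q - p + i)) * (Gamma p / Gamma (q + n)) := by
  induction n generalizing p q with
  | zero => simp
  | succ n ih =>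
    rw [sum_alternating_choose_succ, ih hp hq]
    have h : ∀ m : ℕ, Gamma (p + (m + 1 : ℕ)) / Gamma (q + (m + 1 : ℕ)) =
        Gamma ((p + 1) + m) / Gamma ((q + 1) + m) := fun m => by
      push_cast; congr 2 <;> ring
    simp only [h]
    rw [ih (by linarith) (by linarith), prod_range_succ]
    have hqn : 0 < q + n := by positivity
    have e1 : q + 1 + (n : ℝ) = (q + n) + 1 := by ring
    have e2 : q + ((n + 1 : ℕ) : ℝ) = (q + n) + 1 := by push_cast; ring
    rw [e1, e2, Gamma_add_one hp.ne', Gamma_add_one hqn.ne']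
    have e3 : q + 1 - (p + 1) = q - p := by ring
    rw [e3]
    have := (Gamma_pos_of_pos hqn).ne'
    field_simp
    ring

theorem integrableOn_rpow_mul_one_sub_rpow {a b : ℝ} (ha : -1 < a) (hb : -1 < b) :
    IntegrableOn (fun s : ℝ => s ^ b * (1 - s) ^ a) (Set.Ioo 0 1) := by
  have h := Complex.betaIntegral_convergent (u := ((b + 1 : ℝ) : ℂ)) (v := ((a + 1 : ℝ) : ℂ))
    (by rw [Complex.ofReal_re]; linarith) (by rw [Complex.ofReal_re]; linarith)
  rw [intervalIntegrable_iff_integrableOn_Ioo_of_le zero_le_one] at h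
  refine (IntegrableOn.congr_fun h.re (fun s hs => ?_) measurableSet_Ioo)
  have h1 : (1 - (s : ℂ)) = ((1 - s : ℝ) : ℂ) := by push_cast; ring
  have h2 : ((b + 1 : ℝ) : ℂ) - 1 = ((b : ℝ) : ℂ) := by push_cast; ring
  have h3 : ((a + 1 : ℝ) : ℂ) - 1 = ((a : ℝ) : ℂ) := by push_cast; ring
  simp only [h1, h2, h3, ← Complex.ofReal_cpow hs.1.le, ← Complex.ofReal_cpow (sub_pos.2 hs.2).le,
    ← Complex.ofReal_mul]
  simp

theorem setIntegral_rpow_mul_one_sub_rpow {a b : ℝ} (ha : -1 < a) (hb : -1 < b) :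
    ∫ s in Set.Ioo (0 : ℝ) 1, s ^ b * (1 - s) ^ a =
      Gamma (a + 1) * Gamma (b + 1) / Gamma (a + b + 2) := by
  have h := Complex.betaIntegral_eq_Gamma_mul_div ((b + 1 : ℝ) : ℂ) ((a + 1 : ℝ) : ℂ)
    (by rw [Complex.ofReal_re]; linarith) (by rw [Complex.ofReal_re]; linarith)
  rw [← Complex.ofReal_add, Complex.Gamma_ofReal, Complex.Gamma_ofReal, Complex.Gamma_ofReal,
    Complex.betaIntegral, intervalIntegral.integral_of_le zero_le_one,
    integral_Ioc_eq_integral_Ioo] at h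
  rw [setIntegral_congr_fun (g := fun s : ℝ => ((s ^ b * (1 - s) ^ a : ℝ) : ℂ)) measurableSet_Ioo,
    integral_complex_ofReal] at h
  · have e : a + b + 2 = b + 1 + (a + 1) := by ring
    rw [e, mul_comm (Gamma (a + 1))]
    exact_mod_cast h
  · intro s hs
    have h1 : (1 - (s : ℂ)) = ((1 - s : ℝ) : ℂ) := by push_cast; ring
    have h2 : ((b + 1 : ℝ) : ℂ) - 1 = ((b : ℝ) : ℂ) := by push_cast; ring
    have h3 : ((a + 1 : ℝ) : ℂ) - 1 = ((a : ℝ) : ℂ) := by push_cast; ring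
    simp only [h1, h2, h3, ← Complex.ofReal_cpow hs.1.le,
      ← Complex.ofReal_cpow (sub_pos.2 hs.2).le, ← Complex.ofReal_mul]

theorem jacobiP_two_mul_sub_one (n : ℕ) (a b s : ℝ) :
    jacobiP n a b (2 * s - 1) =
      (Gamma (a + n + 1) / (n.factorial * Gamma (a + b + n + 1))) *
        ∑ m ∈ Finset.range (n + 1), (n.choose m : ℝ) *
          (Gamma (a + b + n + m + 1) / Gamma (a + m + 1)) * ((-1) ^ m * (1 - s) ^ m) := by
  rw [jacobiP]
  congr 1
  refine Finset.sum_congr rfl fun m _ => ?_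
  rw [← mul_pow]
  congr 2
  ring

theorem integrableOn_jacobiP_mul_pow {a b : ℝ} (ha : -1 < a) (hb : -1 < b) (n j : ℕ) :
    IntegrableOn (fun s : ℝ => s ^ b * (1 - s) ^ a * (jacobiP n a b (2 * s - 1) * s ^ j))
      (Set.Ioo 0 1) := by
  have hc : Continuous fun s : ℝ => jacobiP n a b (2 * s - 1) * s ^ j := by
    unfold jacobiP; fun_prop
  have h := integrableOn_rpow_mul_one_sub_rpow ha hb
  rw [← integrableOn_Icc_iff_integrableOn_Ioo] at h ⊢
  exact h.mul_continuousOn hc.continuousOn isCompact_Icc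

theorem setIntegral_jacobiP_mul_pow {a b : ℝ} (ha : -1 < a) (hb : -1 < b) (hab : -1 < a + b)
    {n j : ℕ} (hj : j ≤ n) :
    ∫ s in Set.Ioo (0 : ℝ) 1, s ^ b * (1 - s) ^ a * (jacobiP n a b (2 * s - 1) * s ^ j) =
      if j = n then Gamma (a + n + 1) * Gamma (b + n + 1) / Gamma (a + b + n + n + 2) else 0 := by
  have hterm : ∀ m : ℕ, IntegrableOn (fun s : ℝ => s ^ (b + j) * (1 - s) ^ (a + m)) (Set.Ioo 0 1) :=
    fun m => integrableOn_rpow_mul_one_sub_rpow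
      (by have := Nat.cast_nonneg (α := ℝ) m; linarith)
      (by have := Nat.cast_nonneg (α := ℝ) j; linarith)
  have hval : ∀ m : ℕ, ∫ s in Set.Ioo (0 : ℝ) 1, s ^ (b + j) * (1 - s) ^ (a + m) =
      Gamma (a + m + 1) * Gamma (b + j + 1) / Gamma (a + b + j + 2 + m) := fun m => by
    rw [setIntegral_rpow_mul_one_sub_rpow
      (by have := Nat.cast_nonneg (α := ℝ) m; linarith)
      (by have := Nat.cast_nonneg (α := ℝ) j; linarith)]
    congr 2; ring
  have hexp : Set.EqOn
      (fun s : ℝ => s ^ b * (1 - s) ^ a * (jacobiP n a b (2 * s - 1) * s ^ j))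
      (fun s => ∑ m ∈ Finset.range (n + 1),
        (Gamma (a + n + 1) / (n.factorial * Gamma (a + b + n + 1)) * ((n.choose m : ℝ) *
          (Gamma (a + b + n + m + 1) / Gamma (a + m + 1)) * (-1) ^ m)) *
            (s ^ (b + j) * (1 - s) ^ (a + m))) (Set.Ioo 0 1) := by
    intro s hs
    simp only [jacobiP_two_mul_sub_one, Finset.mul_sum, Finset.sum_mul]
    refine Finset.sum_congr rfl fun m _ => ?_
    rw [rpow_add_natCast hs.1.ne', rpow_add_natCast (sub_pos.2 hs.2).ne']
    ring
  rw [setIntegral_congr_fun measurableSet_Ioo hexp,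
    integral_finsetSum _ fun m _ => (hterm m).const_mul _]
  simp only [integral_const_mul, hval]
  have hn0 : (0 : ℝ) ≤ n := Nat.cast_nonneg n
  have hj0 : (0 : ℝ) ≤ j := Nat.cast_nonneg j
  have hsum := sum_alternating_choose_Gamma_div n (p := a + b + n + 1) (q := a + b + j + 2)
    (by linarith) (by linarith)
  have hG : Gamma (a + b + n + 1) ≠ 0 := (Gamma_pos_of_pos (by linarith)).ne'
  have : ∀ m ∈ Finset.range (n + 1),
      (Gamma (a + n + 1) / (n.factorial * Gamma (a + b + n + 1)) * ((n.choose m : ℝ) *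
          (Gamma (a + b + n + m + 1) / Gamma (a + m + 1)) * (-1) ^ m)) *
        (Gamma (a + m + 1) * Gamma (b + j + 1) / Gamma (a + b + j + 2 + m)) =
      (Gamma (a + n + 1) / (n.factorial * Gamma (a + b + n + 1)) * Gamma (b + j + 1)) *
        ((-1) ^ m * (n.choose m : ℝ) * (Gamma (a + b + n + 1 + m) / Gamma (a + b + j + 2 + m))) := by
    intro m _
    have h1 : Gamma (a + m + 1) ≠ 0 :=
      (Gamma_pos_of_pos (by have := Nat.cast_nonneg (α := ℝ) m; linarith)).ne'
    have e : a + b + n + m + 1 = a + b + n + 1 + m := by ring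
    rw [e]
    field_simp
  rw [Finset.sum_congr rfl this, ← Finset.mul_sum, hsum]
  split_ifs with h
  · subst h
    have e : ∏ i ∈ Finset.range j, (a + b + j + 2 - (a + b + j + 1) + i : ℝ) = j.factorial := by
      rw [← Finset.prod_range_add_one_eq_factorial]
      push_cast
      exact Finset.prod_congr rfl fun i _ => by ring
    have e' : a + b + j + 2 + j = a + b + j + j + 2 := by ring
    rw [e, e']
    have : (j.factorial : ℝ) ≠ 0 := by positivity
    field_simp
  · have hlt : j < n := lt_of_le_of_ne hj h
    rw [Finset.prod_eq_zero (i := n - 1 - j) (Finset.mem_range.2 (by omega)), zero_mul, mul_zero]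
    rw [Nat.cast_sub (by omega), Nat.cast_sub (by omega)]
    push_cast
    ring

open Polynomial in
theorem exists_jacobiP_eq_sum (n : ℕ) (a b : ℝ) : ∃ c : ℕ → ℝ,
    (∀ s, jacobiP n a b (2 * s - 1) = ∑ j ∈ Finset.range (n + 1), c j * s ^ j) ∧
    c n = Gamma (a + n + 1) / (n.factorial * Gamma (a + b + n + 1)) *
      (Gamma (a + b + n + n + 1) / Gamma (a + n + 1)) := by
  set K := Gamma (a + n + 1) / (n.factorial * Gamma (a + b + n + 1)) with hK
  let d : ℕ → ℝ := fun m => K * ((n.choose m : ℝ) *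
          (Gamma (a + b + n + m + 1) / Gamma (a + m + 1)))
  let P : ℝ[X] := ∑ m ∈ Finset.range (n + 1), C (d m) * (X - C 1) ^ m
  have hdeg : P.natDegree ≤ n := by
    refine natDegree_sum_le_of_forall_le _ _ fun m hm => ?_
    refine (natDegree_C_mul_le _ _).trans ?_
    rw [natDegree_pow, natDegree_X_sub_C, mul_one]
    exact Nat.lt_succ_iff.1 (Finset.mem_range.1 hm)
  refine ⟨P.coeff, fun s => ?_, ?_⟩
  · rw [← eval_eq_sum_range' (Nat.lt_succ_of_le hdeg)]
    simp only [P, eval_finsetSum, eval_mul, eval_C, eval_pow, eval_sub, eval_X,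
      jacobiP, Finset.mul_sum, d, ← hK]
    refine Finset.sum_congr rfl fun m _ => ?_
    have : (2 * s - 1 - 1) / 2 = s - 1 := by ring
    rw [this]
    ring
  · simp only [P, finsetSum_coeff, coeff_C_mul]
    rw [Finset.sum_range_succ, Finset.sum_eq_zero, zero_add]
    · have h1 : ((X - C (1 : ℝ)) ^ n).coeff n = 1 := by
        have := (monic_X_sub_C (1 : ℝ)).pow n
        rw [Monic, leadingCoeff, natDegree_pow, natDegree_X_sub_C, mul_one] at this
        exact this
      rw [h1]
      simp [d]
    · intro m hm
      rw [coeff_eq_zero_of_natDegree_lt, mul_zero]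
      rw [natDegree_pow, natDegree_X_sub_C, mul_one]
      exact Finset.mem_range.1 hm

/-- Orthogonality of the Jacobi polynomials, transported to the interval `(0, 1)`. -/
theorem setIntegral_jacobiP_mul_jacobiP {a b : ℝ} (ha : -1 < a) (hb : -1 < b) (hab : -1 < a + b)
    (n k : ℕ) :
    ∫ s in Set.Ioo (0 : ℝ) 1, s ^ b * (1 - s) ^ a *
        (jacobiP n a b (2 * s - 1) * jacobiP k a b (2 * s - 1)) =
      if n = k then Gamma (a + n + 1) * Gamma (b + n + 1) /
        (n.factorial * Gamma (a + b + n + 1) * (a + b + 2 * n + 1)) else 0 := by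
  wlog hkn : k ≤ n generalizing n k
  · have := this k n (by omega)
    simp only [mul_comm (jacobiP n a b _)]
    rw [this, if_neg (by omega), if_neg (by omega)]
  obtain ⟨c, hc, hck⟩ := exists_jacobiP_eq_sum k a b
  have hexp : ∀ s : ℝ, s ^ b * (1 - s) ^ a *
        (jacobiP n a b (2 * s - 1) * jacobiP k a b (2 * s - 1)) =
      ∑ j ∈ Finset.range (k + 1),
        c j * (s ^ b * (1 - s) ^ a * (jacobiP n a b (2 * s - 1) * s ^ j)) := fun s => by
    rw [hc s, Finset.mul_sum, Finset.mul_sum]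
    exact Finset.sum_congr rfl fun j _ => by ring
  simp only [hexp]
  rw [integral_finsetSum _ fun j _ => (integrableOn_jacobiP_mul_pow ha hb n j).const_mul _]
  simp only [integral_const_mul]
  rw [Finset.sum_congr rfl fun j hj => by
    rw [setIntegral_jacobiP_mul_pow ha hb hab
      ((Nat.lt_succ_iff.1 (Finset.mem_range.1 hj)).trans hkn)]]
  simp only [mul_ite, mul_zero, Finset.sum_ite_eq', Finset.mem_range]
  by_cases h : n = k
  · subst h
    have hn0 : (0 : ℝ) ≤ n := Nat.cast_nonneg n
    rw [if_pos (Nat.lt_succ_self n), if_pos rfl, hck]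
    by_cases hd : a + b + n + n + 1 = 0
    · exfalso; linarith
    have h1 : Gamma (a + n + 1) ≠ 0 := (Gamma_pos_of_pos (by linarith)).ne'
    have h2 : Gamma (a + b + n + n + 1) ≠ 0 := (Gamma_pos_of_pos (by linarith)).ne'
    have e : a + b + n + n + 2 = (a + b + n + n + 1) + 1 := by ring
    have e' : a + b + 2 * n + 1 = a + b + n + n + 1 := by ring
    rw [e, Gamma_add_one hd, e']
    field_simp
  · rw [if_neg (by omega), if_neg h]

theorem setIntegral_sin_mul_jacobiP_cos (j p q : ℕ) :
    ∫ θ in Set.Ioo 0 π, sin θ * ((sin θ ^ j * jacobiP p j j (cos θ)) *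
        (sin θ ^ j * jacobiP q j j (cos θ))) =
      2 * 4 ^ j * ∫ s in Set.Ioo (0 : ℝ) 1, s ^ (j : ℝ) * (1 - s) ^ (j : ℝ) *
        (jacobiP p j j (2 * s - 1) * jacobiP q j j (2 * s - 1)) := by
  simp only [rpow_natCast]
  rw [← integral_Ioc_eq_integral_Ioo, ← integral_Ioc_eq_integral_Ioo,
    ← intervalIntegral.integral_of_le pi_pos.le, ← intervalIntegral.integral_of_le zero_le_one]
  have hcont : Continuous fun s : ℝ => s ^ j * (1 - s) ^ j *
        (jacobiP p j j (2 * s - 1) * jacobiP q j j (2 * s - 1)) := by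
    unfold jacobiP; fun_prop
  have h := intervalIntegral.integral_comp_mul_deriv (a := 0) (b := π)
    (f := fun θ => (1 + cos θ) / 2) (f' := fun θ => -sin θ / 2)
    (g := fun s : ℝ => s ^ j * (1 - s) ^ j *
        (jacobiP p j j (2 * s - 1) * jacobiP q j j (2 * s - 1)))
    (fun θ _ => ((hasDerivAt_cos θ).const_add 1).div_const 2)
    (by fun_prop) hcont
  have e0 : (1 + cos 0) / 2 = 1 := by rw [cos_zero]; norm_num
  have e1 : (1 + cos π) / 2 = 0 := by rw [cos_pi]; norm_num
  rw [e0, e1, intervalIntegral.integral_symm 0 1] at h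
  rw [← neg_eq_iff_eq_neg, ← intervalIntegral.integral_neg] at h
  rw [← h, ← intervalIntegral.integral_const_mul]
  refine intervalIntegral.integral_congr fun θ _ => ?_
  have e2 : 2 * ((1 + cos θ) / 2) - 1 = cos θ := by ring
  have e3 : (4 : ℝ) ^ j * (((1 + cos θ) / 2) ^ j * (1 - (1 + cos θ) / 2) ^ j) =
      sin θ ^ j * sin θ ^ j := by
    rw [← mul_pow, ← mul_pow, ← mul_pow]
    congr 1
    nlinarith [sin_sq_add_cos_sq θ]
  simp only [Function.comp, e2]
  linear_combination (-sin θ * jacobiP p j j (cos θ) * jacobiP q j j (cos θ)) * e3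

theorem setIntegral_radial (α β : ℝ) (n k k' : ℕ) (hβ : β = n + 1 / 2) :
    ∫ r in Set.Ioc (0 : ℝ) 1, r ^ 2 * ((jacobiP k α β (2 * r ^ 2 - 1) * r ^ n) *
        (jacobiP k' α β (2 * r ^ 2 - 1) * r ^ n) * (1 - r ^ 2) ^ α) =
      1 / 2 * ∫ s in Set.Ioo (0 : ℝ) 1, s ^ β * (1 - s) ^ α *
        (jacobiP k α β (2 * s - 1) * jacobiP k' α β (2 * s - 1)) := by
  have hI : Set.Ioi (0 : ℝ) ∩ Set.Iio 1 = Set.Ioo 0 1 := Set.Ioi_inter_Iio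
  rw [integral_Ioc_eq_integral_Ioo, ← hI, ← setIntegral_indicator measurableSet_Iio,
    ← setIntegral_indicator measurableSet_Iio, ← integral_comp_rpow_Ioi
      ((Set.Iio 1).indicator fun s : ℝ => s ^ β * (1 - s) ^ α *
        (jacobiP k α β (2 * s - 1) * jacobiP k' α β (2 * s - 1))) (two_ne_zero (α := ℝ)),
    ← integral_const_mul]
  refine setIntegral_congr_fun measurableSet_Ioi fun r (hr : 0 < r) => ?_
  have hmem : (r ^ (2 : ℝ) ∈ Set.Iio (1 : ℝ)) ↔ r ∈ Set.Iio (1 : ℝ) := by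
    rw [Set.mem_Iio, Set.mem_Iio, rpow_two, sq_lt_one_iff₀ hr.le]
  by_cases h : r ∈ Set.Iio (1 : ℝ)
  · simp only [Set.indicator_of_mem h, Set.indicator_of_mem (hmem.2 h)]
    have e1 : (r ^ 2) ^ β = r ^ n * r ^ n * r := by
      rw [hβ, ← rpow_natCast r 2, ← rpow_mul hr.le]
      have : ((2 : ℕ) : ℝ) * (n + 1 / 2) = ((n + n + 1 : ℕ) : ℝ) := by push_cast; ring
      rw [this, rpow_natCast]
      ring
    have e2 : (2 : ℝ) - 1 = 1 := by norm_num
    rw [rpow_two, e1, e2, rpow_one, abs_two, smul_eq_mul]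
    ring
  · simp only [Set.indicator_of_notMem h, Set.indicator_of_notMem (mt hmem.1 h)]
    simp

theorem integral_cos_int_mul (m : ℤ) :
    ∫ φ in -π..π, cos (m * φ) = if m = 0 then 2 * π else 0 := by
  split_ifs with h
  · subst h; simp; ring
  · have hm : (m : ℝ) ≠ 0 := by exact_mod_cast h
    rw [intervalIntegral.integral_comp_mul_left _ hm, integral_cos, mul_neg, sin_neg,
      sin_int_mul_pi]
    simp

theorem integral_sin_int_mul (m : ℤ) : ∫ φ in -π..π, sin (m * φ) = 0 := by
  by_cases h : m = 0
  · subst h; simp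
  · have hm : (m : ℝ) ≠ 0 := by exact_mod_cast h
    rw [intervalIntegral.integral_comp_mul_left _ hm, integral_sin, mul_neg, cos_neg]
    simp

theorem integral_cos_nat_mul_mul_cos_nat_mul (j k : ℕ) :
    ∫ φ in -π..π, cos (j * φ) * cos (k * φ) =
      if j = k then (if j = 0 then 2 * π else π) else 0 := by
  have e : ∀ φ : ℝ, cos (j * φ) * cos (k * φ) =
      (cos (((j - k : ℤ) : ℝ) * φ) + cos (((j + k : ℤ) : ℝ) * φ)) * (1 / 2) := fun φ => by
    push_cast
    rw [sub_mul (j : ℝ) k φ, add_mul (j : ℝ) k φ, cos_sub, cos_add]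
    ring
  simp only [e]
  rw [intervalIntegral.integral_mul_const, intervalIntegral.integral_add
    (Continuous.intervalIntegrable (by fun_prop) _ _)
    (Continuous.intervalIntegrable (by fun_prop) _ _), integral_cos_int_mul, integral_cos_int_mul]
  split_ifs <;> first | omega | ring

theorem integral_sin_nat_mul_mul_sin_nat_mul (j k : ℕ) :
    ∫ φ in -π..π, sin (j * φ) * sin (k * φ) = if j = k ∧ j ≠ 0 then π else 0 := by
  have e : ∀ φ : ℝ, sin (j * φ) * sin (k * φ) =
      (cos (((j - k : ℤ) : ℝ) * φ) - cos (((j + k : ℤ) : ℝ) * φ)) * (1 / 2) := fun φ => by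
    push_cast
    rw [sub_mul (j : ℝ) k φ, add_mul (j : ℝ) k φ, cos_sub, cos_add]
    ring
  simp only [e]
  rw [intervalIntegral.integral_mul_const, intervalIntegral.integral_sub
    (Continuous.intervalIntegrable (by fun_prop) _ _)
    (Continuous.intervalIntegrable (by fun_prop) _ _), integral_cos_int_mul, integral_cos_int_mul]
  split_ifs <;> first | omega | ring

theorem integral_sin_nat_mul_mul_cos_nat_mul (j k : ℕ) :
    ∫ φ in -π..π, sin (j * φ) * cos (k * φ) = 0 := by
  have e : ∀ φ : ℝ, sin (j * φ) * cos (k * φ) =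
      (sin (((j - k : ℤ) : ℝ) * φ) + sin (((j + k : ℤ) : ℝ) * φ)) * (1 / 2) := fun φ => by
    push_cast
    rw [sub_mul (j : ℝ) k φ, add_mul (j : ℝ) k φ, sin_sub, sin_add]
    ring
  simp only [e]
  rw [intervalIntegral.integral_mul_const, intervalIntegral.integral_add
    (Continuous.intervalIntegrable (by fun_prop) _ _)
    (Continuous.intervalIntegrable (by fun_prop) _ _), integral_sin_int_mul, integral_sin_int_mul]
  ring

/-- The azimuthal factor of the spherical harmonic with index `l`. -/
noncomputable def azimuthal (l : ℕ) (φ : ℝ) : ℝ :=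
  if l % 2 = 0 ∨ l = 1 then cos ((l / 2 : ℕ) * φ) else sin ((l / 2 : ℕ) * φ)

/-- The polar factor of the spherical harmonics of degree `n` and order `j`. -/
noncomputable def sphPolar (n j : ℕ) (θ : ℝ) : ℝ := sin θ ^ j * jacobiP (n - j) j j (cos θ)

/-- The normalization constant of the spherical harmonic `Y_l^n`. -/
noncomputable def sphNorm (n l : ℕ) : ℝ := if l = 1 then √((2 * n + 1) / (4 * π)) else sphC n (l / 2)

theorem sphY_eq_mul (n l : ℕ) (θ φ : ℝ) :
    sphY n l θ φ = sphNorm n l * sphPolar n (l / 2) θ * azimuthal l φ := by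
  unfold sphY sphNorm sphPolar azimuthal
  by_cases h1 : l = 1
  · subst h1; simp
  · by_cases h2 : l % 2 = 0 <;> simp only [h1, h2, if_true, if_false, or_false] <;> ring

theorem setIntegral_azimuthal_mul_azimuthal {l l' : ℕ} (hl : 1 ≤ l) (hl' : 1 ≤ l') :
    ∫ φ in Set.Ioo (-π) π, azimuthal l φ * azimuthal l' φ =
      if l = l' then (if l = 1 then 2 * π else π) else 0 := by
  rw [← integral_Ioc_eq_integral_Ioo,
    ← intervalIntegral.integral_of_le (by linarith [pi_pos])]
  unfold azimuthal
  by_cases h : l % 2 = 0 ∨ l = 1 <;> by_cases h' : l' % 2 = 0 ∨ l' = 1 <;>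
    simp only [h, h', if_true, if_false]
  · rw [integral_cos_nat_mul_mul_cos_nat_mul]
    split_ifs <;> first | omega | rfl
  · simp only [mul_comm (cos _)]
    rw [integral_sin_nat_mul_mul_cos_nat_mul, if_neg (by rintro rfl; exact h' h)]
  · rw [integral_sin_nat_mul_mul_cos_nat_mul, if_neg (by rintro rfl; exact h h')]
  · rw [integral_sin_nat_mul_mul_sin_nat_mul]
    split_ifs <;> first | omega | rfl

theorem setIntegral_sin_mul_sphPolar_mul_sphPolar {n n' j : ℕ} (hj : j ≤ n) (hj' : j ≤ n') :
    ∫ θ in Set.Ioo 0 π, sin θ * (sphPolar n j θ * sphPolar n' j θ) =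
      if n = n' then 2 * 4 ^ j * (Gamma (n + 1) ^ 2 /
        (Gamma ((n : ℝ) - j + 1) * Gamma (n + j + 1) * (2 * n + 1))) else 0 := by
  have hj0 : (0 : ℝ) ≤ j := Nat.cast_nonneg j
  unfold sphPolar
  rw [setIntegral_sin_mul_jacobiP_cos, setIntegral_jacobiP_mul_jacobiP (by linarith) (by linarith)
    (by linarith)]
  by_cases h : n = n'
  · subst h
    rw [if_pos rfl, if_pos rfl, ← Gamma_nat_eq_factorial, Nat.cast_sub hj]
    have e1 : (j : ℝ) + (n - j) + 1 = n + 1 := by ring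
    have e2 : (j : ℝ) + j + (n - j) + 1 = n + j + 1 := by ring
    have e3 : (j : ℝ) + j + 2 * (n - j) + 1 = 2 * n + 1 := by ring
    rw [e1, e2, e3, sq]
  · rw [if_neg (by omega), if_neg h, mul_zero]

theorem sphNorm_sq_mul {n l : ℕ} (hl1 : 1 ≤ l) (hl2 : l ≤ 2 * n + 1) :
    sphNorm n l * sphNorm n l * (2 * 4 ^ (l / 2) * (Gamma (n + 1) ^ 2 /
        (Gamma ((n : ℝ) - (l / 2 : ℕ) + 1) * Gamma (n + (l / 2 : ℕ) + 1) * (2 * n + 1)))) *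
      (if l = 1 then 2 * π else π) = 1 := by
  have hj : l / 2 ≤ n := by omega
  have hjr : ((l / 2 : ℕ) : ℝ) ≤ n := by exact_mod_cast hj
  have hpi := pi_pos
  have h1 : 0 < Gamma (n + 1 : ℝ) := Gamma_pos_of_pos (by positivity)
  have h2 : 0 < Gamma ((n : ℝ) - (l / 2 : ℕ) + 1) := Gamma_pos_of_pos (by linarith)
  have h3 : 0 < Gamma ((n : ℝ) + (l / 2 : ℕ) + 1) := Gamma_pos_of_pos (by positivity)
  unfold sphNorm
  split_ifs with h
  · subst h
    rw [mul_self_sqrt (by positivity)]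
    simp
    field_simp
    norm_num
  · unfold sphC
    have hs := mul_self_sqrt (x := (2 * n + 1) * Gamma ((n : ℝ) - (l / 2 : ℕ) + 1) *
      Gamma ((n : ℝ) + (l / 2 : ℕ) + 1) / (2 * π * Gamma ((n : ℝ) + 1) ^ 2)) (by positivity)
    rw [mul_mul_mul_comm (1 / 2 ^ (l / 2) : ℝ) _ (1 / 2 ^ (l / 2) : ℝ), hs]
    have : (4 : ℝ) ^ (l / 2) = 2 ^ (l / 2) * 2 ^ (l / 2) := by rw [← mul_pow]; norm_num
    rw [this]
    field_simp

theorem hNorm_eq {α : ℝ} (hα : -1 < α) (k n : ℕ) :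
    (poch ((n : ℝ) + k + 3 / 2) k / poch ((n : ℝ) + k + α + 3 / 2) k) ^ 2 * (1 / 2 *
      (Gamma (α + k + 1) * Gamma ((n : ℝ) + 1 / 2 + k + 1) /
        (k.factorial * Gamma (α + (n + 1 / 2) + k + 1) * (α + (n + 1 / 2) + 2 * k + 1)))) =
      hNorm α k n := by
  have hn : (0 : ℝ) ≤ n := Nat.cast_nonneg n
  have hk : (0 : ℝ) ≤ k := Nat.cast_nonneg k
  unfold hNorm poch
  have e1 : (n : ℝ) + k + 3 / 2 + k = n + 2 * k + 3 / 2 := by ring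
  have e2 : (n : ℝ) + k + α + 3 / 2 + k = n + 2 * k + α + 3 / 2 := by ring
  have e3 : (n : ℝ) + 2 * k + α + 5 / 2 = n + 2 * k + α + 3 / 2 + 1 := by ring
  have e4 : (n : ℝ) + 1 / 2 + k + 1 = n + k + 3 / 2 := by ring
  have e5 : α + ((n : ℝ) + 1 / 2) + k + 1 = n + k + α + 3 / 2 := by ring
  have e6 : α + ((n : ℝ) + 1 / 2) + 2 * k + 1 = n + 2 * k + α + 3 / 2 := by ring
  have e7 : α + (k : ℝ) + 1 = k + α + 1 := by ring
  have p : 0 < (n : ℝ) + 2 * k + α + 3 / 2 := by linarith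
  rw [e3, Gamma_add_one p.ne', e1, e2, e4, e5, e6, e7, Gamma_nat_eq_factorial]
  have h1 : Gamma ((n : ℝ) + k + 3 / 2) ≠ 0 := (Gamma_pos_of_pos (by linarith)).ne'
  have h2 : Gamma ((n : ℝ) + k + α + 3 / 2) ≠ 0 := (Gamma_pos_of_pos (by linarith)).ne'
  have h3 : Gamma ((n : ℝ) + 2 * k + α + 3 / 2) ≠ 0 := (Gamma_pos_of_pos p).ne'
  field_simp

/-- Spherical coordinates `((r, θ), φ)` on three-dimensional Euclidean space. -/
noncomputable def sphCoord (p : (ℝ × ℝ) × ℝ) : E3 :=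
  !₂[p.1.1 * sin p.1.2 * cos p.2, p.1.1 * sin p.1.2 * sin p.2, p.1.1 * cos p.1.2]

theorem measurable_sphCoord : Measurable sphCoord := by
  unfold sphCoord
  fun_prop

theorem measurePreserving_toLp_prod :
    MeasurePreserving (fun q : ℝ × (ℝ × ℝ) => (!₂[q.2.1, q.2.2, q.1] : E3)) := by
  have h := ((PiLp.volume_preserving_toLp (Fin 3)).comp
    (volume_preserving_piFinSuccAbove (fun _ : Fin 3 => ℝ) 2).symm).comp
      ((MeasurePreserving.id (volume : Measure ℝ)).prod (volume_preserving_finTwoArrow ℝ).symm)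
  convert! h using 1
  ext q i
  fin_cases i <;> rfl

theorem lintegral_eq_lintegral_sphCoord {f : E3 → ENNReal} (hf : Measurable f) :
    ∫⁻ x, f x = ∫⁻ p in (Set.Ioi 0 ×ˢ Set.Ioo 0 π) ×ˢ Set.Ioo (-π) π,
      ENNReal.ofReal (p.1.1 ^ 2 * sin p.1.2) * f (sphCoord p) := by
  let H : ℝ × ℝ → ENNReal := fun q => ∫⁻ φ in Set.Ioo (-π) π,
    f !₂[q.2 * cos φ, q.2 * sin φ, q.1]
  have hH : Measurable H := by
    refine Measurable.lintegral_prod_right' (f := fun x : (ℝ × ℝ) × ℝ =>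
      f !₂[x.1.2 * cos x.2, x.1.2 * sin x.2, x.1.1]) (hf.comp ?_)
    fun_prop
  have hmeas : Measurable fun q : ℝ × (ℝ × ℝ) => f !₂[q.2.1, q.2.2, q.1] :=
    hf.comp measurePreserving_toLp_prod.measurable
  calc ∫⁻ x, f x = ∫⁻ q : ℝ × (ℝ × ℝ), f !₂[q.2.1, q.2.2, q.1] :=
        (measurePreserving_toLp_prod.lintegral_comp hf).symm
    _ = ∫⁻ z : ℝ, ∫⁻ p : ℝ × ℝ, f !₂[p.1, p.2, z] := by
        rw [Measure.volume_eq_prod, lintegral_prod _ hmeas.aemeasurable]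
    _ = ∫⁻ z : ℝ, ∫⁻ ρ in Set.Ioi (0 : ℝ), ENNReal.ofReal ρ * H (z, ρ) := by
        refine lintegral_congr fun z => ?_
        rw [← lintegral_comp_polarCoord_symm, polarCoord_target, Measure.volume_eq_prod,
          ← Measure.prod_restrict, lintegral_prod]
        · refine lintegral_congr fun ρ => ?_
          simp only [polarCoord_symm_apply, smul_eq_mul, H]
          rw [lintegral_const_mul]
          exact hf.comp (by fun_prop)
        · refine Measurable.aemeasurable ?_
          simp only [polarCoord_symm_apply, smul_eq_mul]
          exact Measurable.mul (by fun_prop) (hf.comp (by fun_prop))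
    _ = ∫⁻ q : ℝ × ℝ, (Set.Ioi (0 : ℝ)).indicator (fun ρ => ENNReal.ofReal ρ * H (q.1, ρ)) q.2 := by
        rw [Measure.volume_eq_prod, lintegral_prod]
        · simp only [lintegral_indicator measurableSet_Ioi]
        · have : (fun q : ℝ × ℝ =>
              (Set.Ioi (0 : ℝ)).indicator (fun ρ => ENNReal.ofReal ρ * H (q.1, ρ)) q.2) =
              (Prod.snd ⁻¹' Set.Ioi (0 : ℝ)).indicator
                (fun q => ENNReal.ofReal q.2 * H q) := rfl
          rw [this]
          exact (Measurable.indicator (by fun_prop)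
            (measurable_snd measurableSet_Ioi)).aemeasurable
    _ = ∫⁻ q in Set.Ioi 0 ×ˢ Set.Ioo (-π) π, (Set.Ioi 0 ×ˢ Set.Ioo 0 π).indicator
          (fun q : ℝ × ℝ => ENNReal.ofReal (q.1 ^ 2 * sin q.2) *
            H (q.1 * cos q.2, q.1 * sin q.2)) q := by
        rw [← lintegral_comp_polarCoord_symm, polarCoord_target]
        refine setLIntegral_congr_fun (measurableSet_Ioi.prod measurableSet_Ioo) fun q hq => ?_
        obtain ⟨hr : 0 < q.1, hθ⟩ := hq
        simp only [polarCoord_symm_apply, smul_eq_mul]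
        by_cases h : q ∈ Set.Ioi (0 : ℝ) ×ˢ Set.Ioo 0 π
        · have hs : 0 < sin q.2 := sin_pos_of_mem_Ioo h.2
          rw [Set.indicator_of_mem h, Set.indicator_of_mem (Set.mem_Ioi.2 (by positivity)),
            ← mul_assoc, ← ENNReal.ofReal_mul hr.le]
          congr 2
          ring
        · have hle : q.2 ≤ 0 := not_lt.1 fun h0 => h ⟨hr, h0, hθ.2⟩
          have hs : sin q.2 ≤ 0 := sin_nonpos_of_nonpos_of_neg_pi_le hle hθ.1.le
          rw [Set.indicator_of_notMem h, Set.indicator_of_notMem, mul_zero]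
          exact not_lt.2 (mul_nonpos_of_nonneg_of_nonpos hr.le hs)
    _ = ∫⁻ q in Set.Ioi 0 ×ˢ Set.Ioo 0 π, ENNReal.ofReal (q.1 ^ 2 * sin q.2) *
            H (q.1 * cos q.2, q.1 * sin q.2) := by
        rw [setLIntegral_indicator (measurableSet_Ioi.prod measurableSet_Ioo),
          Set.inter_eq_left.2]
        exact Set.prod_mono le_rfl (Set.Ioo_subset_Ioo_left (by linarith [pi_pos]))
    _ = _ := by
        rw [Measure.volume_eq_prod (ℝ × ℝ) ℝ, ← Measure.prod_restrict, lintegral_prod]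
        · refine lintegral_congr fun q => ?_
          simp only [H, sphCoord]
          rw [lintegral_const_mul]
          exact hf.comp (by fun_prop)
        · exact (Measurable.mul (by fun_prop) (hf.comp measurable_sphCoord)).aemeasurable

theorem integral_eq_setIntegral_sphCoord {F : E3 → ℝ} (hF : Measurable F) :
    ∫ x, F x = ∫ p in (Set.Ioi 0 ×ˢ Set.Ioo 0 π) ×ˢ Set.Ioo (-π) π,
      p.1.1 ^ 2 * sin p.1.2 * F (sphCoord p) := by
  set S : Set ((ℝ × ℝ) × ℝ) := (Set.Ioi 0 ×ˢ Set.Ioo 0 π) ×ˢ Set.Ioo (-π) π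
  have hSm : MeasurableSet S :=
    (measurableSet_Ioi.prod measurableSet_Ioo).prod measurableSet_Ioo
  have hd : Measurable fun p : (ℝ × ℝ) × ℝ => ENNReal.ofReal (p.1.1 ^ 2 * sin p.1.2) := by
    fun_prop
  have hmap : ((volume.restrict S).withDensity
      fun p : (ℝ × ℝ) × ℝ => ENNReal.ofReal (p.1.1 ^ 2 * sin p.1.2)).map sphCoord = volume := by
    refine Measure.ext_of_lintegral _ fun f hf => ?_
    rw [lintegral_map hf measurable_sphCoord,
      lintegral_withDensity_eq_lintegral_mul _ hd (g := fun p => f (sphCoord p))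
        (hf.comp measurable_sphCoord),
      lintegral_eq_lintegral_sphCoord hf]
    rfl
  rw [← hmap, integral_map measurable_sphCoord.aemeasurable hF.aestronglyMeasurable,
    integral_withDensity_eq_integral_toReal_smul hd (by simp)]
  refine setIntegral_congr_fun hSm fun p hp => ?_
  have : 0 < sin p.1.2 := sin_pos_of_mem_Ioo hp.1.2
  rw [ENNReal.toReal_ofReal (by positivity), smul_eq_mul]

theorem norm_sphCoord {p : (ℝ × ℝ) × ℝ} (hr : 0 < p.1.1) : ‖sphCoord p‖ = p.1.1 := by
  rw [EuclideanSpace.norm_eq, sqrt_eq_iff_mul_self_eq (by positivity) hr.le, Fin.sum_univ_three]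
  simp only [sphCoord, norm_eq_abs, sq_abs]
  simp
  linear_combination p.1.1 ^ 2 * sin_sq_add_cos_sq p.1.2 +
    p.1.1 ^ 2 * sin p.1.2 ^ 2 * sin_sq_add_cos_sq p.2

theorem solidY_sphCoord (n l : ℕ) {p : (ℝ × ℝ) × ℝ}
    (hp : p ∈ (Set.Ioi (0 : ℝ) ×ˢ Set.Ioo 0 π) ×ˢ Set.Ioo (-π) π) :
    solidY n l (sphCoord p) = p.1.1 ^ n *
      (sphNorm n l * sphPolar n (l / 2) p.1.2 * azimuthal l p.2) := by
  obtain ⟨⟨hr : 0 < p.1.1, hθ⟩, hφ⟩ := hp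
  have hs : 0 < sin p.1.2 := sin_pos_of_mem_Ioo hθ
  rw [solidY, norm_sphCoord hr]
  have e1 : arccos (p.1.1⁻¹ * sphCoord p 2) = p.1.2 := by
    have : sphCoord p 2 = p.1.1 * cos p.1.2 := rfl
    rw [this, inv_mul_cancel_left₀ hr.ne', arccos_cos hθ.1.le hθ.2.le]
  have e2 : Complex.arg (sphCoord p 0 + sphCoord p 1 * Complex.I) = p.2 := by
    have h0 : sphCoord p 0 = p.1.1 * sin p.1.2 * cos p.2 := rfl
    have h1 : sphCoord p 1 = p.1.1 * sin p.1.2 * sin p.2 := rfl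
    rw [h0, h1]
    convert Complex.arg_mul_cos_add_sin_mul_I (mul_pos hr hs) ⟨hφ.1, hφ.2.le⟩ using 2
    push_cast
    ring
  rw [e1, e2, sphY_eq_mul]

theorem measurable_ballB (α : ℝ) (k n l : ℕ) : Measurable (ballB α k n l) := by
  have hJ : ∀ (m : ℕ) (a b : ℝ), Measurable (jacobiP m a b) := fun m a b => by
    refine Continuous.measurable ?_
    unfold jacobiP
    fun_prop
  have hθ : Measurable fun x : E3 => arccos (‖x‖⁻¹ * x 2) :=
    continuous_arccos.measurable.comp (by fun_prop)
  have hφ : Measurable fun x : E3 => Complex.arg (x 0 + x 1 * Complex.I) :=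
    Complex.measurable_arg.comp (by fun_prop)
  have hY : Measurable (solidY n l) := by
    unfold solidY
    simp only [sphY_eq_mul, sphPolar, azimuthal]
    have hc := (hJ (n - l / 2) (l / 2 : ℕ) (l / 2 : ℕ)).comp (measurable_cos.comp hθ)
    refine Measurable.mul (by fun_prop) (Measurable.mul (Measurable.mul measurable_const
      (Measurable.mul ((measurable_sin.comp hθ).pow_const _) hc)) ?_)
    split_ifs
    · exact measurable_cos.comp (hφ.const_mul _)
    · exact measurable_sin.comp (hφ.const_mul _)
  have hR : Measurable fun x : E3 => 2 * ‖x‖ ^ 2 - 1 := by fun_prop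
  exact (((hJ k α _).comp hR).const_mul _).mul hY

theorem setIntegral_ballB_mul_ballB (α : ℝ) (k k' n n' l l' : ℕ) :
    ∫ x in Metric.closedBall (0 : E3) 1,
        ballB α k n l x * ballB α k' n' l' x * (1 - ‖x‖ ^ 2) ^ α =
      poch ((n : ℝ) + k + 3 / 2) k / poch ((n : ℝ) + k + α + 3 / 2) k *
        (poch ((n' : ℝ) + k' + 3 / 2) k' / poch ((n' : ℝ) + k' + α + 3 / 2) k') *
        (sphNorm n l * sphNorm n' l') *
      ((∫ r in Set.Ioc (0 : ℝ) 1, r ^ 2 * ((jacobiP k α (n + 1 / 2) (2 * r ^ 2 - 1) * r ^ n) *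
          (jacobiP k' α (n' + 1 / 2) (2 * r ^ 2 - 1) * r ^ n') * (1 - r ^ 2) ^ α)) *
        (∫ θ in Set.Ioo 0 π, sin θ * (sphPolar n (l / 2) θ * sphPolar n' (l' / 2) θ)) *
        ∫ φ in Set.Ioo (-π) π, azimuthal l φ * azimuthal l' φ) := by
  have hF : Measurable fun x : E3 =>
      ballB α k n l x * ballB α k' n' l' x * (1 - ‖x‖ ^ 2) ^ α :=
    ((measurable_ballB α k n l).mul (measurable_ballB α k' n' l')).mul (by fun_prop)
  have hR : Set.Ioc (0 : ℝ) 1 = Set.Ioi 0 ∩ Set.Iic 1 := Set.Ioi_inter_Iic.symm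
  rw [← integral_indicator Metric.isClosed_closedBall.measurableSet,
    integral_eq_setIntegral_sphCoord
      (hF.indicator Metric.isClosed_closedBall.measurableSet),
    hR, ← setIntegral_indicator measurableSet_Iic, ← setIntegral_prod_mul, ← setIntegral_prod_mul,
    ← integral_const_mul]
  refine setIntegral_congr_fun
    ((measurableSet_Ioi.prod measurableSet_Ioo).prod measurableSet_Ioo) fun p hp => ?_
  have hr : 0 < p.1.1 := hp.1.1
  have hmem : sphCoord p ∈ Metric.closedBall (0 : E3) 1 ↔ p.1.1 ∈ Set.Iic (1 : ℝ) := by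
    rw [mem_closedBall_zero_iff, norm_sphCoord hr, Set.mem_Iic]
  by_cases h : p.1.1 ∈ Set.Iic (1 : ℝ)
  · simp only [Set.indicator_of_mem h, Set.indicator_of_mem (hmem.2 h), ballB,
      norm_sphCoord hr, solidY_sphCoord _ _ hp]
    ring
  · simp only [Set.indicator_of_notMem h, Set.indicator_of_notMem (mt hmem.1 h)]
    ring

/-- orthogonality of the ball polynomials with respect to the
weight `(1 - ‖x‖²)^α` on the unit ball. -/
theorem ball_polynomials_orthogonal (α : ℝ) (hα : -1 < α) (k k' n n' l l' : ℕ)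
    (hl1 : 1 ≤ l) (hl2 : l ≤ 2 * n + 1) (hl1' : 1 ≤ l') (hl2' : l' ≤ 2 * n' + 1) :
    (∫ x in Metric.closedBall (0 : E3) 1,
        ballB α k n l x * ballB α k' n' l' x * (1 - ‖x‖ ^ 2) ^ α) =
      if k = k' ∧ l = l' ∧ n = n' then hNorm α k n else 0 := by
  rw [setIntegral_ballB_mul_ballB, setIntegral_azimuthal_mul_azimuthal hl1 hl1']
  by_cases hl : l = l'
  swap
  · simp [hl]
  subst hl
  rw [setIntegral_sin_mul_sphPolar_mul_sphPolar (by omega) (by omega)]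
  by_cases hn : n = n'
  swap
  · simp [hn]
  subst hn
  have hn0 : (0 : ℝ) ≤ n := Nat.cast_nonneg n
  rw [setIntegral_radial α _ n k k' rfl,
    setIntegral_jacobiP_mul_jacobiP hα (by linarith) (by linarith)]
  by_cases hk : k = k'
  swap
  · simp [hk]
  subst hk
  simp only [if_true, and_self]
  rw [← hNorm_eq hα k n]
  linear_combination (poch ((n : ℝ) + k + 3 / 2) k / poch ((n : ℝ) + k + α + 3 / 2) k) ^ 2 *
    (1 / 2 * (Gamma (α + k + 1) * Gamma ((n : ℝ) + 1 / 2 + k + 1) /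
      (k.factorial * Gamma (α + (n + 1 / 2) + k + 1) * (α + (n + 1 / 2) + 2 * k + 1)))) *
    sphNorm_sq_mul hl1 hl2
end

section
/- For every α > −1, k, n ∈ ℕ₀ and 1 ≤ l ≤ 2n+1, the ball polynomial B_{k,l}^{α,n} is an eigenfunction of the weighted second-order differential operator: for every x in the open unit ball B³ ⊂ ℝ³, −(1−‖x‖²)^{−α} ∇·[(I − x xᵀ)(1−‖x‖²)^{α} ∇B_{k,l}^{α,n}(x)] = (n+2k)(n+2k+2α+3) B_{k,l}^{α,n}(x), where I denotes the 3×3 identity matrix and x xᵀ the outer product of x with itself. -/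
open MeasureTheory Real
open scoped RealInnerProductSpace

open MvPolynomial in
/-- The squared Euclidean norm as a polynomial in the three coordinates. -/
noncomputable def radiusSq : MvPolynomial (Fin 3) ℝ := X 0 ^ 2 + X 1 ^ 2 + X 2 ^ 2

open MvPolynomial in
theorem pderiv_radiusSq (i : Fin 3) : pderiv i radiusSq = 2 * X i := by
  fin_cases i <;> simp [radiusSq, pderiv_X]

open MvPolynomial in
theorem pderiv_radial (J : Polynomial ℝ) (R : MvPolynomial (Fin 3) ℝ) (i : Fin 3) :
    pderiv i (Polynomial.aeval R J) =
      Polynomial.aeval R (Polynomial.derivative J) * pderiv i R := by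
  rw [Derivation.map_aeval, smul_eq_mul]

open MvPolynomial in
theorem weighted_divergence_identity (α N c : ℝ) (P : MvPolynomial (Fin 3) ℝ)
    (J : Polynomial ℝ)
    (hom : X 0 * pderiv 0 P + X 1 * pderiv 1 P + X 2 * pderiv 2 P = C N * P)
    (lap : pderiv 0 (pderiv 0 P) + pderiv 1 (pderiv 1 P) + pderiv 2 (pderiv 2 P) = 0)
    (ode : Polynomial.X * (1 - Polynomial.X) * Polynomial.derivative (Polynomial.derivative J)
      + (Polynomial.C (N + 3 / 2) - Polynomial.C (α + N + 5 / 2) * Polynomial.X)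
        * Polynomial.derivative J + Polynomial.C c * J = 0)
    (F E : MvPolynomial (Fin 3) ℝ)
    (hF : F = Polynomial.aeval radiusSq J * P)
    (hE : E = X 0 * pderiv 0 F + X 1 * pderiv 1 F + X 2 * pderiv 2 F) :
    pderiv 0 (pderiv 0 F - E * X 0) + pderiv 1 (pderiv 1 F - E * X 1)
      + pderiv 2 (pderiv 2 F - E * X 2) - C (2 * α) * E
      = - C (4 * c + N * (N + 2 * α + 3)) * F := by
  have hR : radiusSq = X 0 ^ 2 + X 1 ^ 2 + X 2 ^ 2 := rfl
  have hRi := pderiv_radiusSq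
  set J0 := Polynomial.aeval radiusSq J with hJ0
  set J1 := Polynomial.aeval radiusSq (Polynomial.derivative J) with hJ1
  set J2 := Polynomial.aeval radiusSq (Polynomial.derivative (Polynomial.derivative J)) with hJ2
  have ode' := congrArg (Polynomial.aeval radiusSq) ode
  rw [map_add, map_add, map_mul, map_mul, map_mul, map_sub, map_sub, map_mul, map_mul] at ode'
  simp only [Polynomial.aeval_X, Polynomial.aeval_C, map_one, map_zero,
    ← hJ0, ← hJ1, ← hJ2, algebraMap_eq] at ode'
  have d0 : ∀ i, pderiv i J0 = J1 * pderiv i radiusSq := fun i => pderiv_radial J _ i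
  have d1 : ∀ i, pderiv i J1 = J2 * pderiv i radiusSq := fun i => pderiv_radial _ _ i
  have hE' : E = (2 * radiusSq * J1 + C N * J0) * P := by
    rw [hE, hF]
    simp only [Derivation.leibniz, smul_eq_mul, d0, hRi]
    linear_combination J0 * hom - 2 * J1 * P * hR
  have c2 : (2 : MvPolynomial (Fin 3) ℝ) = C 2 := (map_ofNat C 2).symm
  have p2 : ∀ i : Fin 3, pderiv i (2 : MvPolynomial (Fin 3) ℝ) = 0 := fun i => by
    rw [c2]; exact pderiv_C
  have e1 : (C (α + N + 5/2) : MvPolynomial (Fin 3) ℝ) * 2 = 2 * C α + 2 * C N + 5 := by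
    have : (5 : MvPolynomial (Fin 3) ℝ) = C 5 := (map_ofNat C 5).symm
    rw [this, c2]; simp only [← C_mul, ← C_add]; congr 1; ring
  have e2 : (C (N + 3/2) : MvPolynomial (Fin 3) ℝ) * 2 = 2 * C N + 3 := by
    have : (3 : MvPolynomial (Fin 3) ℝ) = C 3 := (map_ofNat C 3).symm
    rw [this, c2]; simp only [← C_mul, ← C_add]; congr 1; ring
  have e3 : (C (4 * c + N * (N + 2 * α + 3)) : MvPolynomial (Fin 3) ℝ)
      = 4 * C c + C N * (C N + 2 * C α + 3) := by
    have h3 : (3 : MvPolynomial (Fin 3) ℝ) = C 3 := (map_ofNat C 3).symm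
    have h4 : (4 : MvPolynomial (Fin 3) ℝ) = C 4 := (map_ofNat C 4).symm
    rw [h3, h4, c2]; simp only [← C_mul, ← C_add]
  have e4 : (C (2 * α) : MvPolynomial (Fin 3) ℝ) = 2 * C α := by rw [c2, C_mul]
  have hEi : ∀ i, pderiv i E = (2 * pderiv i radiusSq * J1 + 2 * radiusSq * J2 * pderiv i radiusSq
      + C N * J1 * pderiv i radiusSq) * P + (2 * radiusSq * J1 + C N * J0) * pderiv i P := fun i => by
    rw [hE']
    simp only [Derivation.leibniz, smul_eq_mul, d0, d1, map_add, p2, pderiv_C]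
    ring
  simp only [map_sub, Derivation.leibniz, smul_eq_mul, hEi]
  rw [e3, e4, hE', hF]
  simp only [Derivation.leibniz, smul_eq_mul, map_add, d0, d1, hRi, p2, pderiv_X,
    Pi.single_eq_same]
  linear_combination J0 * lap + (4 * J1 - 2 * radiusSq * J1 - C N * J0) * hom
    + 4 * P * ode' + 2 * J1 * P * (radiusSq * e1 - e2)
    + ((4 + 2 * C N) * P * J1 - 4 * P * J2 * (1 - radiusSq)) * hR

/-- Coefficients of the Jacobi polynomial in the variable `u = (t - 1) / 2`, without normalization. -/
noncomputable def jacobiCoeff (n : ℕ) (α β : ℝ) (m : ℕ) : ℝ :=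
  (n.choose m : ℝ) * (Real.Gamma (α + β + n + m + 1) / Real.Gamma (α + m + 1))

theorem jacobiCoeff_succ (n : ℕ) {α β : ℝ} (hα : -1 < α) (hαβ : 0 < α + β + 1) (m : ℕ) :
    (m + 1) * (m + 1 + α) * jacobiCoeff n α β (m + 1)
      = (n - m) * (n + m + α + β + 1) * jacobiCoeff n α β m := by
  have h1 : (0 : ℝ) < α + m + 1 := by have : (0:ℝ) ≤ m := m.cast_nonneg; linarith
  have h2 : (0 : ℝ) < α + β + n + m + 1 := by
    have : (0:ℝ) ≤ m := m.cast_nonneg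
    have : (0:ℝ) ≤ n := n.cast_nonneg
    linarith
  have g1 := Real.Gamma_add_one h1.ne'
  have g2 := Real.Gamma_add_one h2.ne'
  have hG := (Real.Gamma_pos_of_pos h1).ne'
  have hc : ((n.choose (m + 1) : ℕ) : ℝ) * (m + 1) = n.choose m * (n - m) := by
    rcases le_or_gt m n with h | h
    · have := Nat.choose_succ_right_eq n m
      rw [← Nat.cast_sub h]; exact_mod_cast this
    · simp [Nat.choose_eq_zero_of_lt h, Nat.choose_eq_zero_of_lt (Nat.lt_succ_of_lt h)]
  unfold jacobiCoeff
  have r1 : α + ((m + 1 : ℕ) : ℝ) + 1 = α + m + 1 + 1 := by push_cast; ring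
  have r2 : α + β + n + ((m + 1 : ℕ) : ℝ) + 1 = α + β + n + m + 1 + 1 := by push_cast; ring
  rw [r1, r2, g1, g2]
  field_simp
  linear_combination (α + β + n + m + 1) * (α + m + 1) * hc

open Polynomial in
/-- The Jacobi polynomial as a polynomial in the variable `u = (t - 1) / 2`. -/
noncomputable def jacobiPoly (n : ℕ) (α β : ℝ) : ℝ[X] :=
  C (Real.Gamma (α + n + 1) / (n.factorial * Real.Gamma (α + β + n + 1))) *
    ∑ m ∈ Finset.range (n + 1), C (jacobiCoeff n α β m) * X ^ m

theorem jacobiP_eq_eval (n : ℕ) (α β t : ℝ) :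
    jacobiP n α β t = (jacobiPoly n α β).eval ((t - 1) / 2) := by
  simp [jacobiP, jacobiPoly, jacobiCoeff, Polynomial.eval_finsetSum]

open Polynomial in
theorem jacobiPoly_natDegree_le (n : ℕ) (α β : ℝ) : (jacobiPoly n α β).natDegree ≤ n := by
  refine (natDegree_C_mul_le _ _).trans (natDegree_sum_le_of_forall_le _ _ fun m hm => ?_)
  exact (natDegree_C_mul_X_pow_le _ _).trans (Nat.lt_succ_iff.mp (Finset.mem_range.mp hm))

open Polynomial in
theorem jacobiPoly_ode (n : ℕ) {α β : ℝ} (hα : -1 < α) (hαβ : 0 < α + β + 1) :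
    X * (1 + X) * derivative (derivative (jacobiPoly n α β))
      + (C (α + 1) + C (α + β + 2) * X) * derivative (jacobiPoly n α β)
      - C (n * (n + α + β + 1)) * jacobiPoly n α β = 0 := by
  set T : ℕ → ℝ[X] := fun m => C (m * (m + α) * jacobiCoeff n α β m) * X ^ (m - 1) with hT
  set S : ℝ[X] := ∑ m ∈ Finset.range (n + 1), C (jacobiCoeff n α β m) * X ^ m with hS
  have key : X * (1 + X) * derivative (derivative S)
      + (C (α + 1) + C (α + β + 2) * X) * derivative S
      - C (n * (n + α + β + 1)) * S = 0 := by
    have h : ∀ m, X * (1 + X) * derivative (derivative (C (jacobiCoeff n α β m) * X ^ m))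
        + (C (α + 1) + C (α + β + 2) * X) * derivative (C (jacobiCoeff n α β m) * X ^ m)
        - C (n * (n + α + β + 1)) * (C (jacobiCoeff n α β m) * X ^ m) = T m - T (m + 1) := by
      intro m
      have hr := congrArg (C : ℝ → ℝ[X]) (jacobiCoeff_succ n hα hαβ m)
      simp only [hT]
      push_cast
      rw [hr]
      have c2 : (C (2 : ℝ) : ℝ[X]) = 2 := map_ofNat C 2
      rcases m with _ | _ | m
      · simp
      · simp [c2]; ring
      · simp only [derivative_C_mul, derivative_X_pow]
        simp [c2]
        ring
    rw [hS]
    simp only [derivative_sum, Finset.mul_sum, ← Finset.sum_add_distrib, ← Finset.sum_sub_distrib,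
      h]
    rw [Finset.sum_range_sub']
    simp [hT, jacobiCoeff]
  unfold jacobiPoly
  simp only [derivative_C_mul, ← hS]
  linear_combination C (Real.Gamma (α + n + 1) / (n.factorial * Real.Gamma (α + β + n + 1))) * key

open MvPolynomial in
/-- Real and imaginary part of `(X₀ + i X₁)^j`. -/
noncomputable def reImPow : ℕ → MvPolynomial (Fin 3) ℝ × MvPolynomial (Fin 3) ℝ
  | 0 => (1, 0)
  | j + 1 => (X 0 * (reImPow j).1 - X 1 * (reImPow j).2, X 0 * (reImPow j).2 + X 1 * (reImPow j).1)

open MvPolynomial in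
theorem eval_reImPow (v : Fin 3 → ℝ) (j : ℕ) :
    eval v (reImPow j).1 = (((v 0 : ℂ) + v 1 * Complex.I) ^ j).re ∧
      eval v (reImPow j).2 = (((v 0 : ℂ) + v 1 * Complex.I) ^ j).im := by
  induction j with
  | zero => simp [reImPow]
  | succ j ih =>
    simp only [reImPow, map_sub, map_add, map_mul, eval_X, ih.1, ih.2, pow_succ, Complex.mul_re,
      Complex.mul_im]
    constructor <;> simp <;> ring

open MvPolynomial in
theorem pderiv_reImPow (j : ℕ) :
    pderiv 0 (reImPow (j + 1)).1 = (j + 1) * (reImPow j).1 ∧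
    pderiv 1 (reImPow (j + 1)).1 = -((j + 1) * (reImPow j).2) ∧
    pderiv 0 (reImPow (j + 1)).2 = (j + 1) * (reImPow j).2 ∧
    pderiv 1 (reImPow (j + 1)).2 = (j + 1) * (reImPow j).1 := by
  induction j with
  | zero => simp [reImPow, pderiv_X]
  | succ j ih =>
    obtain ⟨h1, h2, h3, h4⟩ := ih
    rw [reImPow]
    simp only [map_sub, map_add, Derivation.leibniz, smul_eq_mul, h1, h2, h3, h4]
    rw [reImPow]
    simp only [pderiv_X]
    push_cast
    refine ⟨?_, ?_, ?_, ?_⟩ <;> simp <;> ring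

open MvPolynomial in
theorem pderiv_two_reImPow (j : ℕ) :
    pderiv 2 (reImPow j).1 = 0 ∧ pderiv 2 (reImPow j).2 = 0 := by
  induction j with
  | zero => simp [reImPow]
  | succ j ih => simp [reImPow, ih.1, ih.2, pderiv_X]

open MvPolynomial in
/-- A planar harmonic, homogeneous polynomial of degree `j` in the first two variables. -/
structure IsPlanarHarmonic (j : ℕ) (A : MvPolynomial (Fin 3) ℝ) : Prop where
  pderiv_two : pderiv 2 A = 0
  euler : X 0 * pderiv 0 A + X 1 * pderiv 1 A = (j : MvPolynomial (Fin 3) ℝ) * A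
  laplace : pderiv 0 (pderiv 0 A) + pderiv 1 (pderiv 1 A) = 0

open MvPolynomial in
theorem isPlanarHarmonic_reImPow (j : ℕ) :
    IsPlanarHarmonic j (reImPow j).1 ∧ IsPlanarHarmonic j (reImPow j).2 := by
  have hc : ∀ (i : Fin 3) (j : ℕ), pderiv i ((j : MvPolynomial (Fin 3) ℝ) + 1) = 0 := fun i j => by
    simp
  rcases j with _ | _ | j
  · exact ⟨⟨by simp [reImPow], by simp [reImPow], by simp [reImPow]⟩,
      ⟨by simp [reImPow], by simp [reImPow], by simp [reImPow]⟩⟩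
  · obtain ⟨h1, h2, h3, h4⟩ := pderiv_reImPow 0
    refine ⟨⟨(pderiv_two_reImPow _).1, ?_, ?_⟩, ⟨(pderiv_two_reImPow _).2, ?_, ?_⟩⟩ <;>
      simp [h1, h2, h3, h4] <;> simp [reImPow]
  · obtain ⟨h1, h2, h3, h4⟩ := pderiv_reImPow (j + 1)
    obtain ⟨k1, k2, k3, k4⟩ := pderiv_reImPow j
    refine ⟨⟨(pderiv_two_reImPow _).1, ?_, ?_⟩, ⟨(pderiv_two_reImPow _).2, ?_, ?_⟩⟩
    · rw [h1, h2, reImPow.eq_2 (j + 1)]; push_cast; ring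
    · simp only [h1, h2, map_neg, Derivation.leibniz, smul_eq_mul, k1, k4, hc]; ring
    · rw [h3, h4, reImPow.eq_2 (j + 1)]; push_cast; ring
    · simp only [h3, h4, Derivation.leibniz, smul_eq_mul, k3, k2, hc]; ring

/-- Coefficients of the Gegenbauer polynomial `∑ d_q t^(m-2q)`. -/
noncomputable def gegenCoeff (j m : ℕ) : ℕ → ℝ
  | 0 => 1
  | q + 1 => -((m - 2 * q) * (m - 2 * q - 1)) / ((2 * q + 2) * (2 * m - 2 * q - 1 + 2 * j)) *
      gegenCoeff j m q

theorem gegenCoeff_succ {j m q : ℕ} (hq : 2 * q ≤ m) :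
    (2 * (q + 1)) * (2 * m - 2 * (q + 1) + 1 + 2 * j) * gegenCoeff j m (q + 1) =
      -((m - 2 * q) * (m - 2 * q - 1)) * gegenCoeff j m q := by
  rcases Nat.eq_zero_or_pos m with rfl | hm
  · obtain rfl : q = 0 := by omega
    simp [gegenCoeff]
  · have h : (0 : ℝ) < 2 * m - 2 * q - 1 + 2 * j := by
      have h1 : (2 * q : ℝ) ≤ m := by exact_mod_cast hq
      have h2 : (1 : ℝ) ≤ m := by exact_mod_cast hm
      by_cases h3 : m = 1
      · obtain rfl : q = 0 := by omega
        subst h3; norm_num; positivity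
      · have : (2 : ℝ) ≤ m := by exact_mod_cast (show 2 ≤ m by omega)
        have : (0 : ℝ) ≤ j := j.cast_nonneg
        linarith
    have h' : (2 * m - 2 * (q + 1) + 1 + 2 * j : ℝ) = 2 * m - 2 * q - 1 + 2 * j := by ring
    rw [gegenCoeff, h']
    have h'' := h.ne'
    have hq' : (2 * q + 2 : ℝ) ≠ 0 := by positivity
    generalize (2 * m - 2 * q - 1 + 2 * j : ℝ) = D at h'' ⊢
    field_simp

theorem gegenCoeff_boundary (j m : ℕ) :
    (2 * ((m / 2 + 1 : ℕ) : ℝ)) * (2 * m - 2 * ((m / 2 + 1 : ℕ) : ℝ) + 1 + 2 * j)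
      * gegenCoeff j m (m / 2 + 1) = 0 := by
  have := gegenCoeff_succ (j := j) (m := m) (q := m / 2) (by omega)
  push_cast at this ⊢
  rw [this]
  have h : (m : ℝ) = 2 * ((m / 2 : ℕ) : ℝ) + ((m % 2 : ℕ) : ℝ) := by
    exact_mod_cast (Nat.div_add_mod m 2).symm
  rcases Nat.mod_two_eq_zero_or_one m with h2 | h2 <;> rw [h2] at h <;> push_cast at h
  · have : (m : ℝ) - 2 * ((m / 2 : ℕ) : ℝ) = 0 := by linarith
    rw [this]; ring
  · have : (m : ℝ) - 2 * ((m / 2 : ℕ) : ℝ) = 1 := by linarith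
    rw [this]; ring

open Polynomial in
/-- The Gegenbauer polynomial of degree `m` and index `j + 1/2`, normalized to be monic. -/
noncomputable def gegenPoly (j m : ℕ) : ℝ[X] :=
  ∑ q ∈ Finset.range (m / 2 + 1), C (gegenCoeff j m q) * X ^ (m - 2 * q)

open Polynomial in
theorem gegenPoly_ode (j m : ℕ) :
    (1 - X ^ 2) * derivative (derivative (gegenPoly j m))
      - C (2 * j + 2 : ℝ) * X * derivative (gegenPoly j m)
      + C (m * (m + 2 * j + 1) : ℝ) * gegenPoly j m = 0 := by
  set T : ℕ → ℝ[X] := fun q =>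
    C (2 * q * (2 * m - 2 * q + 1 + 2 * j) * gegenCoeff j m q) * X ^ (m - 2 * q) with hT
  have h : ∀ q ∈ Finset.range (m / 2 + 1),
      (1 - X ^ 2) * derivative (derivative (C (gegenCoeff j m q) * X ^ (m - 2 * q)))
      - C (2 * j + 2 : ℝ) * X * derivative (C (gegenCoeff j m q) * X ^ (m - 2 * q))
      + C (m * (m + 2 * j + 1) : ℝ) * (C (gegenCoeff j m q) * X ^ (m - 2 * q))
        = T q - T (q + 1) := by
    intro q hq
    have hq' : 2 * q ≤ m := by have := Finset.mem_range.mp hq; omega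
    have hr := congrArg (C : ℝ → ℝ[X]) (gegenCoeff_succ (j := j) hq')
    obtain ⟨i, rfl⟩ := Nat.exists_eq_add_of_le hq'
    simp only [hT]
    push_cast at hr ⊢
    rw [hr]
    have e : 2 * q + i - 2 * (q + 1) = i - 2 := by omega
    have e' : 2 * q + i - 2 * q = i := by omega
    rw [e, e']
    have c2 : (C (2 : ℝ) : ℝ[X]) = 2 := map_ofNat C 2
    rcases i with _ | _ | i
    · simp [c2]; ring_nf; simp
    · simp [c2]; ring
    · simp only [derivative_C_mul, derivative_X_pow]
      simp [c2]
      ring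
  unfold gegenPoly
  simp only [derivative_sum, Finset.mul_sum, ← Finset.sum_add_distrib, ← Finset.sum_sub_distrib]
  rw [Finset.sum_congr rfl h, Finset.sum_range_sub']
  simp only [hT]
  rw [gegenCoeff_boundary]
  simp

open MvPolynomial in
/-- The homogenization `r^m G(z / r)` of the Gegenbauer polynomial `G = gegenPoly j m`. -/
noncomputable def gegenSolid (j m : ℕ) : MvPolynomial (Fin 3) ℝ :=
  ∑ q ∈ Finset.range (m / 2 + 1),
    C (gegenCoeff j m q) * (X 2 ^ (m - 2 * q) * radiusSq ^ q)

open MvPolynomial in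
theorem pderiv_X_two_pow (i : ℕ) :
    pderiv 0 (X 2 ^ i : MvPolynomial (Fin 3) ℝ) = 0 ∧
    pderiv 1 (X 2 ^ i : MvPolynomial (Fin 3) ℝ) = 0 ∧
    X 2 * pderiv 2 (X 2 ^ i : MvPolynomial (Fin 3) ℝ) = (i : MvPolynomial (Fin 3) ℝ) * X 2 ^ i ∧
    pderiv 2 (pderiv 2 (X 2 ^ i : MvPolynomial (Fin 3) ℝ)) =
      (i : MvPolynomial (Fin 3) ℝ) * ((i : MvPolynomial (Fin 3) ℝ) - 1) * X 2 ^ (i - 2) := by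
  rcases i with _ | _ | i
  · simp
  · simp [pderiv_X]
  · refine ⟨?_, ?_, ?_, ?_⟩ <;> simp [Derivation.leibniz_pow, pderiv_X] <;> ring

open MvPolynomial in
theorem pderiv_radiusSq_pow (i : Fin 3) (q : ℕ) :
    pderiv i (radiusSq ^ q) = 2 * (q : MvPolynomial (Fin 3) ℝ) * radiusSq ^ (q - 1) * X i := by
  rw [Derivation.leibniz_pow, pderiv_radiusSq]
  simp
  ring

open MvPolynomial in
theorem euler_radiusSq_pow (q : ℕ) :
    X 0 * pderiv 0 (radiusSq ^ q) + X 1 * pderiv 1 (radiusSq ^ q)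
      + X 2 * pderiv 2 (radiusSq ^ q) = 2 * (q : MvPolynomial (Fin 3) ℝ) * radiusSq ^ q := by
  have hR : radiusSq = X 0 ^ 2 + X 1 ^ 2 + X 2 ^ 2 := rfl
  simp only [pderiv_radiusSq_pow]
  rcases q with _ | q
  · simp
  · push_cast
    linear_combination -2 * ((q : MvPolynomial (Fin 3) ℝ) + 1) * radiusSq ^ q * hR

open MvPolynomial in
theorem laplace_radiusSq_pow (q : ℕ) :
    pderiv 0 (pderiv 0 (radiusSq ^ q)) + pderiv 1 (pderiv 1 (radiusSq ^ q))
      + pderiv 2 (pderiv 2 (radiusSq ^ q)) =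
      2 * (q : MvPolynomial (Fin 3) ℝ) * (2 * q + 1) * radiusSq ^ (q - 1) := by
  have hc : ∀ (i : Fin 3) (j : ℕ), pderiv i (j : MvPolynomial (Fin 3) ℝ) = 0 :=
    fun i j => by simp
  have hc2 : ∀ i : Fin 3, pderiv i (2 : MvPolynomial (Fin 3) ℝ) = 0 := fun i => hc i 2
  have he := euler_radiusSq_pow (q - 1)
  simp only [pderiv_radiusSq_pow _ q, Derivation.leibniz, smul_eq_mul, hc, hc2, pderiv_X,
    Pi.single_eq_same]
  rcases q with _ | q
  · simp
  · rw [Nat.add_sub_cancel] at *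
    push_cast
    linear_combination 2 * ((q : MvPolynomial (Fin 3) ℝ) + 1) * he

open MvPolynomial in
theorem IsPlanarHarmonic.euler_mul {j : ℕ} {A : MvPolynomial (Fin 3) ℝ}
    (hA : IsPlanarHarmonic j A) (m : ℕ) :
    X 0 * pderiv 0 (A * gegenSolid j m) + X 1 * pderiv 1 (A * gegenSolid j m)
      + X 2 * pderiv 2 (A * gegenSolid j m) = C ((j + m : ℕ) : ℝ) * (A * gegenSolid j m) := by
  unfold gegenSolid
  simp only [Finset.mul_sum, map_sum, ← Finset.sum_add_distrib]
  refine Finset.sum_congr rfl fun q hq => ?_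
  have hq' : 2 * q ≤ m := by have := Finset.mem_range.mp hq; omega
  obtain ⟨i, rfl⟩ := Nat.exists_eq_add_of_le hq'
  have e' : 2 * q + i - 2 * q = i := by omega
  rw [e']
  have h1 := hA.euler
  have h2 := hA.pderiv_two
  have hR : radiusSq = X 0 ^ 2 + X 1 ^ 2 + X 2 ^ 2 := rfl
  have hN : (C ((j + (2 * q + i) : ℕ) : ℝ) : MvPolynomial (Fin 3) ℝ) = j + (2 * q + i) := by
    rw [map_natCast]; push_cast; ring
  rw [hN]
  generalize gegenCoeff j (2 * q + i) q = d
  obtain ⟨z0, z1, z2, -⟩ := pderiv_X_two_pow i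
  have hq1 := euler_radiusSq_pow q
  simp only [Derivation.leibniz, smul_eq_mul, pderiv_C, h2, z0, z1]
  linear_combination C d * X 2 ^ i * radiusSq ^ q * h1 + A * C d * X 2 ^ i * hq1
    + A * C d * radiusSq ^ q * z2

open MvPolynomial in
theorem IsPlanarHarmonic.laplace_mul {j : ℕ} {A : MvPolynomial (Fin 3) ℝ}
    (hA : IsPlanarHarmonic j A) (m : ℕ) :
    pderiv 0 (pderiv 0 (A * gegenSolid j m)) + pderiv 1 (pderiv 1 (A * gegenSolid j m))
      + pderiv 2 (pderiv 2 (A * gegenSolid j m)) = 0 := by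
  set T : ℕ → MvPolynomial (Fin 3) ℝ := fun q =>
    C (2 * q * (2 * m - 2 * q + 1 + 2 * j) * gegenCoeff j m q) *
      (A * (X 2 ^ (m - 2 * q) * radiusSq ^ (q - 1))) with hT
  have h : ∀ q ∈ Finset.range (m / 2 + 1),
      pderiv 0 (pderiv 0 (A * (C (gegenCoeff j m q) * (X 2 ^ (m - 2 * q) * radiusSq ^ q))))
      + pderiv 1 (pderiv 1 (A * (C (gegenCoeff j m q) * (X 2 ^ (m - 2 * q) * radiusSq ^ q))))
      + pderiv 2 (pderiv 2 (A * (C (gegenCoeff j m q) * (X 2 ^ (m - 2 * q) * radiusSq ^ q))))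
        = T q - T (q + 1) := by
    intro q hq
    have hq' : 2 * q ≤ m := by have := Finset.mem_range.mp hq; omega
    have hr := congrArg (C : ℝ → MvPolynomial (Fin 3) ℝ) (gegenCoeff_succ (j := j) hq')
    obtain ⟨i, rfl⟩ := Nat.exists_eq_add_of_le hq'
    simp only [hT]
    push_cast at hr ⊢
    rw [hr]
    have e : 2 * q + i - 2 * (q + 1) = i - 2 := by omega
    have e' : 2 * q + i - 2 * q = i := by omega
    rw [e, e']
    have h1 := hA.euler
    have h2 := hA.pderiv_two
    have h3 := hA.laplace
    have c2 : (C (2 : ℝ) : MvPolynomial (Fin 3) ℝ) = 2 := map_ofNat C 2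
    generalize gegenCoeff j (2 * q + i) q = d
    obtain ⟨z0, z1, z2, z22⟩ := pderiv_X_two_pow i
    have hL := laplace_radiusSq_pow q
    have hP := fun i => pderiv_radiusSq_pow i q
    simp only [Derivation.leibniz, smul_eq_mul, pderiv_C, h2, z0, z1, z22, map_add, map_zero]
    simp only [map_mul, map_sub, map_add, map_neg, map_natCast, map_one, c2]
    linear_combination C d * X 2 ^ i * radiusSq ^ q * h3
      + C d * A * X 2 ^ i * hL
      + 4 * C d * X 2 ^ i * (q : MvPolynomial (Fin 3) ℝ) * radiusSq ^ (q - 1) * h1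
      + 4 * C d * A * (q : MvPolynomial (Fin 3) ℝ) * radiusSq ^ (q - 1) * z2
      + 2 * C d * X 2 ^ i * pderiv 0 A * hP 0 + 2 * C d * X 2 ^ i * pderiv 1 A * hP 1
      + 2 * C d * A * pderiv 2 (X 2 ^ i : MvPolynomial (Fin 3) ℝ) * hP 2
  unfold gegenSolid
  simp only [Finset.mul_sum, map_sum, ← Finset.sum_add_distrib]
  rw [Finset.sum_congr rfl h, Finset.sum_range_sub']
  simp only [hT]
  rw [gegenCoeff_boundary]
  simp

open Polynomial in
theorem eq_zero_of_gegenbauer_ode (j m : ℕ) (D : ℝ[X]) (hdeg : D.natDegree ≤ m)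
    (hm : D.coeff m = 0)
    (ode : (1 - X ^ 2) * derivative (derivative D) - C (2 * j + 2 : ℝ) * X * derivative D
      + C (m * (m + 2 * j + 1) : ℝ) * D = 0) : D = 0 := by
  have hθ : ∀ (p : ℝ[X]) (i : ℕ), (X * derivative p).coeff i = i * p.coeff i := by
    intro p i
    rcases i with _ | i
    · simp
    · rw [coeff_X_mul, coeff_derivative]; push_cast; ring
  have ode' : derivative (derivative D) - X * derivative (X * derivative D)
      - C (2 * j + 1 : ℝ) * (X * derivative D) + C (m * (m + 2 * j + 1) : ℝ) * D = 0 := by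
    have e : C (2 * j + 2 : ℝ) = C (2 * j + 1 : ℝ) + 1 := by
      rw [← C_1, ← C_add]; congr 1; ring
    rw [e] at ode
    simp only [derivative_mul, derivative_X]
    linear_combination ode
  have hrec : ∀ i : ℕ, ((i : ℝ) + 2) * (i + 1) * D.coeff (i + 2)
      = -((m - i) * (m + i + 2 * j + 1)) * D.coeff i := by
    intro i
    have h := congrArg (fun p => p.coeff i) ode'
    simp only [coeff_add, coeff_sub, coeff_C_mul, hθ, coeff_derivative, coeff_zero] at h
    push_cast at h
    linear_combination h
  have key : ∀ r i : ℕ, m ≤ i + r → D.coeff i = 0 := by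
    intro r
    induction r with
    | zero =>
      intro i hi
      rcases eq_or_lt_of_le hi with h | h
      · rw [← hm]; congr 1; omega
      · exact coeff_eq_zero_of_natDegree_lt (by omega)
    | succ r ih =>
      intro i hi
      by_cases h : m ≤ i + r
      · exact ih i h
      have h2 := hrec i
      rw [ih (i + 2) (by omega), mul_zero] at h2
      have hlt : (i : ℝ) < m := by exact_mod_cast (show i < m by omega)
      have hne : -(((m : ℝ) - i) * (m + i + 2 * j + 1)) ≠ 0 :=
        neg_ne_zero.mpr (mul_ne_zero (by linarith) (by positivity))
      exact (mul_eq_zero.mp h2.symm).resolve_left hne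
  ext i
  exact key m i (by omega)

open Polynomial in
theorem gegenPoly_natDegree_le (j m : ℕ) : (gegenPoly j m).natDegree ≤ m :=
  natDegree_sum_le_of_forall_le _ _ fun _ _ =>
    (natDegree_C_mul_X_pow_le _ _).trans (Nat.sub_le _ _)

open Polynomial in
theorem gegenPoly_coeff_self (j m : ℕ) : (gegenPoly j m).coeff m = 1 := by
  rw [gegenPoly, finsetSum_coeff, Finset.sum_eq_single 0]
  · simp [gegenCoeff]
  · intro q hq h0
    have := Finset.mem_range.mp hq
    rw [coeff_C_mul, coeff_X_pow, if_neg (by omega), mul_zero]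
  · simp

open Polynomial in
/-- The ultraspherical Jacobi polynomials are multiples of `gegenPoly`. -/
theorem exists_jacobiP_eq_gegenPoly (j m : ℕ) :
    ∃ c : ℝ, ∀ t, jacobiP m j j t = c * (gegenPoly j m).eval t := by
  have hj : (0 : ℝ) ≤ j := j.cast_nonneg
  have hode := jacobiPoly_ode m (α := j) (β := j) (by linarith) (by linarith)
  set Q := jacobiPoly m (j : ℝ) j with hQ
  set u : ℝ[X] := C (1 / 2) * (X - 1) with hu
  set p := Q.comp u with hp
  have hdu : derivative u = C (1 / 2) := by simp [hu]
  have h2 : (2 : ℝ[X]) * C (1 / 2) = 1 := by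
    rw [← map_ofNat C 2, ← C_mul]; norm_num
  have hp1 : derivative p = C (1 / 2) * (derivative Q).comp u := by
    rw [hp, derivative_comp, hdu]
  have hp2 : derivative (derivative p) = C (1 / 2) * C (1 / 2) * (derivative (derivative Q)).comp u := by
    rw [hp1, derivative_C_mul, derivative_comp, hdu]; ring
  have ode : (1 - X ^ 2) * derivative (derivative p) - C (2 * j + 2 : ℝ) * X * derivative p
      + C (m * (m + 2 * j + 1) : ℝ) * p = 0 := by
    have h := congrArg (fun q => q.comp u) hode
    simp only [add_comp, sub_comp, mul_comp, X_comp, C_comp, one_comp, zero_comp] at h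
    have e1 : C (j + j + 2 : ℝ) = C (2 * j + 2 : ℝ) := by congr 1; ring
    have e2 : C (m * (m + j + j + 1) : ℝ) = C (m * (m + 2 * j + 1) : ℝ) := by congr 1; ring
    have e3 : 2 * C (j + 1 : ℝ) = C (2 * j + 2 : ℝ) := by
      rw [← map_ofNat C 2, ← C_mul]; congr 1; ring
    rw [e1, e2, ← e3] at h
    rw [hp2, hp1, ← e3, hp]
    have hX : X = 2 * u + 1 := by rw [hu]; linear_combination (1 - X) * h2
    set a := (derivative (derivative Q)).comp u
    set b := (derivative Q).comp u
    rw [hX]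
    have h4 : C (1 / 2 : ℝ) * C (1 / 2) * 4 = (1 : ℝ[X]) := by
      linear_combination (2 * C (1 / 2) + 1) * h2
    linear_combination -h - (u + u ^ 2) * a * h4 - C (j + 1 : ℝ) * (2 * u + 1) * b * h2
  have hpdeg : p.natDegree ≤ m := by
    have h1 : u.natDegree ≤ 1 := by
      refine (natDegree_C_mul_le _ _).trans ?_
      rw [← C_1]; exact natDegree_X_sub_C_le _
    calc p.natDegree ≤ Q.natDegree * u.natDegree := natDegree_comp_le
      _ ≤ m * 1 := Nat.mul_le_mul (jacobiPoly_natDegree_le _ _ _) h1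
      _ = m := mul_one m
  have hD : p - C (p.coeff m) * gegenPoly j m = 0 := by
    refine eq_zero_of_gegenbauer_ode j m _ ?_ ?_ ?_
    · exact (natDegree_sub_le _ _).trans
        (max_le hpdeg ((natDegree_C_mul_le _ _).trans (gegenPoly_natDegree_le j m)))
    · rw [coeff_sub, coeff_C_mul, gegenPoly_coeff_self]; ring
    · simp only [derivative_sub, derivative_C_mul]
      linear_combination ode - C (p.coeff m) * gegenPoly_ode j m
  refine ⟨p.coeff m, fun t => ?_⟩
  have h := congrArg (eval t) (sub_eq_zero.mp hD)
  rw [eval_mul, eval_C] at h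
  rw [← h, jacobiP_eq_eval, hp, eval_comp, hu]
  congr 1
  simp; ring

theorem norm_pow_mul_gegenPoly_eval (j m : ℕ) (x : E3) :
    ‖x‖ ^ m * (gegenPoly j m).eval (‖x‖⁻¹ * x 2)
      = MvPolynomial.eval (fun i => x i) (gegenSolid j m) := by
  have hn : ‖x‖ ^ 2 = x 0 ^ 2 + x 1 ^ 2 + x 2 ^ 2 := by
    rw [EuclideanSpace.norm_sq_eq, Fin.sum_univ_three]; simp
  rw [gegenPoly, gegenSolid, Polynomial.eval_finsetSum, map_sum, Finset.mul_sum]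
  refine Finset.sum_congr rfl fun q hq => ?_
  have hq' : 2 * q ≤ m := by have := Finset.mem_range.mp hq; omega
  obtain ⟨i, rfl⟩ := Nat.exists_eq_add_of_le hq'
  have e : 2 * q + i - 2 * q = i := by omega
  simp only [e, radiusSq, Polynomial.eval_mul, Polynomial.eval_C, Polynomial.eval_pow,
    Polynomial.eval_X, map_mul, map_add, map_pow, MvPolynomial.eval_C, MvPolynomial.eval_X]
  rw [← hn, pow_add, pow_mul]
  rcases eq_or_ne x 0 with rfl | hx
  · rcases i with _ | i <;> simp [mul_comm]
  · have := norm_ne_zero_iff.mpr hx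
    rw [mul_pow, inv_pow]
    field_simp

theorem norm_mul_sin_arccos (x : E3) :
    ‖x‖ * Real.sin (Real.arccos (‖x‖⁻¹ * x 2)) = ‖(x 0 : ℂ) + x 1 * Complex.I‖ := by
  have hn : ‖x‖ ^ 2 = x 0 ^ 2 + x 1 ^ 2 + x 2 ^ 2 := by
    rw [EuclideanSpace.norm_sq_eq, Fin.sum_univ_three]; simp
  rw [Complex.norm_add_mul_I, Real.sin_arccos]
  rcases eq_or_ne x 0 with rfl | hx
  · simp
  · have := norm_pos_iff.mpr hx
    nth_rewrite 1 [← Real.sqrt_sq this.le]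
    rw [← Real.sqrt_mul (sq_nonneg _)]
    congr 1
    field_simp
    linarith

theorem cos_arccos_coord (x : E3) :
    Real.cos (Real.arccos (‖x‖⁻¹ * x 2)) = ‖x‖⁻¹ * x 2 := by
  have h : |‖x‖⁻¹ * x 2| ≤ 1 := by
    rw [abs_mul, abs_inv, abs_norm, inv_mul_eq_div]
    exact div_le_one_of_le₀ (by simpa using PiLp.norm_apply_le x 2) (norm_nonneg _)
  exact Real.cos_arccos (neg_le_of_abs_le h) (le_of_abs_le h)

theorem norm_pow_mul_cos_sin_arg (w : ℂ) (j : ℕ) :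
    ‖w‖ ^ j * Real.cos (j * w.arg) = (w ^ j).re ∧
      ‖w‖ ^ j * Real.sin (j * w.arg) = (w ^ j).im := by
  have h : w ^ j = ((‖w‖ ^ j : ℝ) : ℂ) * Complex.exp ((j * w.arg : ℝ) * Complex.I) := by
    conv_lhs => rw [← Complex.norm_mul_exp_arg_mul_I w, mul_pow, ← Complex.exp_nat_mul]
    push_cast
    ring_nf
  rw [h, Complex.re_ofReal_mul, Complex.im_ofReal_mul, Complex.exp_ofReal_mul_I_re,
    Complex.exp_ofReal_mul_I_im]
  exact ⟨rfl, rfl⟩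

/-- Every solid spherical harmonic is a planar harmonic times a Gegenbauer polynomial. -/
theorem exists_solidY_eq_eval (n l : ℕ) (hl1 : 1 ≤ l) (hl2 : l ≤ 2 * n + 1) :
    ∃ (c : ℝ) (j m : ℕ) (A : MvPolynomial (Fin 3) ℝ), j + m = n ∧ IsPlanarHarmonic j A ∧
      ∀ x : E3, solidY n l x = c * MvPolynomial.eval (fun i => x i) (A * gegenSolid j m) := by
  obtain ⟨m, hm⟩ : ∃ m, l / 2 + m = n := ⟨n - l / 2, by omega⟩
  obtain ⟨d, hd⟩ := exists_jacobiP_eq_gegenPoly (l / 2) m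
  have hmn : n - l / 2 = m := by omega
  by_cases h1 : l = 1
  · subst h1
    have hm' : m = n := by simpa using hm
    subst hm'
    refine ⟨Real.sqrt ((2 * m + 1) / (4 * Real.pi)) * d, 0, m, (reImPow 0).1, by simp,
      (isPlanarHarmonic_reImPow 0).1, fun x => ?_⟩
    have hd' := hd (‖x‖⁻¹ * x 2)
    norm_num at hd'
    rw [solidY, sphY, if_pos rfl, cos_arccos_coord, hd', map_mul,
      ← norm_pow_mul_gegenPoly_eval, reImPow]
    simp
    ring
  · have hs : ∀ x : E3, ‖x‖ ^ n * Real.sin (Real.arccos (‖x‖⁻¹ * x 2)) ^ (l / 2) =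
        ‖(x 0 : ℂ) + x 1 * Complex.I‖ ^ (l / 2) * ‖x‖ ^ m := fun x => by
      rw [← norm_mul_sin_arccos, mul_pow, ← hm, pow_add]; ring
    by_cases h2 : l % 2 = 0
    · refine ⟨sphC n (l / 2) * d, l / 2, m, (reImPow (l / 2)).1, hm,
        (isPlanarHarmonic_reImPow _).1, fun x => ?_⟩
      rw [solidY, sphY, if_neg h1, if_pos h2, cos_arccos_coord, hmn, hd, map_mul,
        ← norm_pow_mul_gegenPoly_eval, (eval_reImPow _ _).1, ← (norm_pow_mul_cos_sin_arg _ _).1]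
      linear_combination (sphC n (l / 2) * Real.cos ((l / 2 : ℕ) *
        Complex.arg (x 0 + x 1 * Complex.I)) * d *
        (gegenPoly (l / 2) m).eval (‖x‖⁻¹ * x 2)) * hs x
    · refine ⟨sphC n (l / 2) * d, l / 2, m, (reImPow (l / 2)).2, hm,
        (isPlanarHarmonic_reImPow _).2, fun x => ?_⟩
      rw [solidY, sphY, if_neg h1, if_neg h2, cos_arccos_coord, hmn, hd, map_mul,
        ← norm_pow_mul_gegenPoly_eval, (eval_reImPow _ _).2, ← (norm_pow_mul_cos_sin_arg _ _).2]
      linear_combination (sphC n (l / 2) * Real.sin ((l / 2 : ℕ) *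
        Complex.arg (x 0 + x 1 * Complex.I)) * d *
        (gegenPoly (l / 2) m).eval (‖x‖⁻¹ * x 2)) * hs x

theorem hasFDerivAt_eval_mvPolynomial (P : MvPolynomial (Fin 3) ℝ) (y : E3) :
    HasFDerivAt (fun z : E3 => MvPolynomial.eval (fun i => z i) P)
      (∑ i, MvPolynomial.eval (fun i => y i) (MvPolynomial.pderiv i P) •
        (EuclideanSpace.proj i : E3 →L[ℝ] ℝ)) y := by
  induction P using MvPolynomial.induction_on with
  | C a => simpa using hasFDerivAt_const a y
  | add p q hp hq =>
    simp only [map_add, add_smul, Finset.sum_add_distrib]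
    exact hp.add hq
  | mul_X p n hp =>
    have h := hp.mul (EuclideanSpace.proj n : E3 →L[ℝ] ℝ).hasFDerivAt
    simp only [map_mul, MvPolynomial.eval_X]
    refine h.congr_fderiv ?_
    ext v
    simp [MvPolynomial.pderiv_X, Pi.single_apply, add_mul, Finset.sum_add_distrib, Finset.mul_sum]
    fin_cases n <;> simp [Fin.sum_univ_three] <;> ring

theorem gradient_eval_mvPolynomial (P : MvPolynomial (Fin 3) ℝ) (y : E3) :
    gradient (fun z : E3 => MvPolynomial.eval (fun i => z i) P) y =
      WithLp.toLp 2 fun i => MvPolynomial.eval (fun i => y i) (MvPolynomial.pderiv i P) := by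
  refine HasGradientAt.gradient ?_
  rw [hasGradientAt_iff_hasFDerivAt]
  refine (hasFDerivAt_eval_mvPolynomial P y).congr_fderiv ?_
  ext v
  simp [PiLp.inner_apply, Fin.sum_univ_three, mul_comm]

theorem eval_radiusSq (y : E3) : MvPolynomial.eval (fun i => y i) radiusSq = ‖y‖ ^ 2 := by
  rw [EuclideanSpace.norm_sq_eq, Fin.sum_univ_three]; simp [radiusSq]

/-- Each component of a polynomial vector field multiplied by the weight is differentiable in the
open unit ball. -/
theorem hasFDerivAt_weight_mul_eval (α : ℝ) (W : MvPolynomial (Fin 3) ℝ) {x : E3} (hx : ‖x‖ < 1) :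
    HasFDerivAt (fun y : E3 => (1 - ‖y‖ ^ 2) ^ α * MvPolynomial.eval (fun i => y i) W)
      (∑ i, ((1 - ‖x‖ ^ 2) ^ α * MvPolynomial.eval (fun i => x i) (MvPolynomial.pderiv i W)
        - 2 * α * x i * (1 - ‖x‖ ^ 2) ^ (α - 1) * MvPolynomial.eval (fun i => x i) W) •
        (EuclideanSpace.proj i : E3 →L[ℝ] ℝ)) x := by
  have hpos : 0 < 1 - ‖x‖ ^ 2 := by nlinarith [norm_nonneg x]
  have h1 := hasFDerivAt_eval_mvPolynomial (1 - radiusSq) x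
  simp only [map_sub, map_one, eval_radiusSq] at h1
  have h2 := (h1.rpow_const (p := α) (Or.inl hpos.ne')).mul (hasFDerivAt_eval_mvPolynomial W x)
  refine h2.congr_fderiv ?_
  ext v
  simp [pderiv_radiusSq, Fin.sum_univ_three]
  ring

theorem weighted_divergence_eval (α N c : ℝ) (P : MvPolynomial (Fin 3) ℝ)
    (J : Polynomial ℝ)
    (hom : MvPolynomial.X 0 * MvPolynomial.pderiv 0 P + MvPolynomial.X 1 * MvPolynomial.pderiv 1 P
      + MvPolynomial.X 2 * MvPolynomial.pderiv 2 P = MvPolynomial.C N * P)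
    (lap : MvPolynomial.pderiv 0 (MvPolynomial.pderiv 0 P)
      + MvPolynomial.pderiv 1 (MvPolynomial.pderiv 1 P)
      + MvPolynomial.pderiv 2 (MvPolynomial.pderiv 2 P) = 0)
    (ode : Polynomial.X * (1 - Polynomial.X) * Polynomial.derivative (Polynomial.derivative J)
      + (Polynomial.C (N + 3 / 2) - Polynomial.C (α + N + 5 / 2) * Polynomial.X)
        * Polynomial.derivative J + Polynomial.C c * J = 0)
    (f : E3 → ℝ)
    (hf : f = fun y => MvPolynomial.eval (fun i => y i) (Polynomial.aeval radiusSq J * P))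
    (x : E3) (hx : ‖x‖ < 1) :
    -((1 - ‖x‖ ^ 2) ^ (-α)) *
        (∑ i : Fin 3,
          fderiv ℝ (fun y : E3 =>
              ((1 - ‖y‖ ^ 2) ^ α) • (gradient f y - ⟪y, gradient f y⟫ • y))
            x (EuclideanSpace.single i 1) i) =
      (4 * c + N * (N + 2 * α + 3)) * f x := by
  set F := Polynomial.aeval radiusSq J * P with hF
  set E := MvPolynomial.X 0 * MvPolynomial.pderiv 0 F + MvPolynomial.X 1 * MvPolynomial.pderiv 1 F
    + MvPolynomial.X 2 * MvPolynomial.pderiv 2 F with hE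
  set W : Fin 3 → MvPolynomial (Fin 3) ℝ :=
    fun i => MvPolynomial.pderiv i F - E * MvPolynomial.X i with hW
  have hV : (fun y : E3 => ((1 - ‖y‖ ^ 2) ^ α) • (gradient f y - ⟪y, gradient f y⟫ • y)) =
      fun y => WithLp.toLp 2 fun i =>
        (1 - ‖y‖ ^ 2) ^ α * MvPolynomial.eval (fun i => y i) (W i) := by
    funext y
    have hin : ⟪y, gradient f y⟫ = MvPolynomial.eval (fun i => y i) E := by
      rw [hf, gradient_eval_mvPolynomial, hE]
      simp [PiLp.inner_apply, Fin.sum_univ_three, mul_comm]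
    rw [hin]
    ext i
    rw [hf, gradient_eval_mvPolynomial]
    simp [hW]
  have hd : ∀ i, fderiv ℝ (fun y : E3 => ((1 - ‖y‖ ^ 2) ^ α) •
      (gradient f y - ⟪y, gradient f y⟫ • y)) x (EuclideanSpace.single i 1) i =
      (1 - ‖x‖ ^ 2) ^ α * MvPolynomial.eval (fun i => x i) (MvPolynomial.pderiv i (W i))
        - 2 * α * x i * (1 - ‖x‖ ^ 2) ^ (α - 1) * MvPolynomial.eval (fun i => x i) (W i) := by
    intro i
    rw [hV]
    have hdiff : DifferentiableAt ℝ (fun y : E3 => (WithLp.toLp 2 fun i =>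
        (1 - ‖y‖ ^ 2) ^ α * MvPolynomial.eval (fun i => y i) (W i) : E3)) x :=
      differentiableAt_euclidean.mpr fun i =>
        (hasFDerivAt_weight_mul_eval α (W i) hx).differentiableAt
    have h1 := (EuclideanSpace.proj i : E3 →L[ℝ] ℝ).hasFDerivAt.comp x hdiff.hasFDerivAt
    have h2 := h1.unique (hasFDerivAt_weight_mul_eval α (W i) hx)
    have h3 := congrArg (fun L : E3 →L[ℝ] ℝ => L (EuclideanSpace.single i 1)) h2
    refine Eq.trans ?_ (h3.trans ?_)
    · rfl
    · simp
  have hpos : 0 < 1 - ‖x‖ ^ 2 := by nlinarith [norm_nonneg x]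
  have hid := congrArg (MvPolynomial.eval (fun i => x i))
    (weighted_divergence_identity α N c P J hom lap ode F E hF hE)
  have hn := eval_radiusSq x
  have hEx := congrArg (MvPolynomial.eval (fun i => x i)) hE
  have hfx : f x = MvPolynomial.eval (fun i => x i) F := by rw [hf]
  simp only [radiusSq, map_add, map_sub, map_mul, map_neg, map_pow, MvPolynomial.eval_X,
    MvPolynomial.eval_C] at hid hn hEx
  simp only [hd, Fin.sum_univ_three, hfx]
  have hw : (1 - ‖x‖ ^ 2) ^ α = (1 - ‖x‖ ^ 2) ^ (α - 1) * (1 - ‖x‖ ^ 2) := by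
    rw [← Real.rpow_add_one hpos.ne']; congr 1; ring
  have hinv : (1 - ‖x‖ ^ 2) ^ (-α) * (1 - ‖x‖ ^ 2) ^ α = 1 := by
    rw [← Real.rpow_add hpos]; simp
  simp only [hW, map_sub, map_mul, MvPolynomial.eval_X]
  set r := (1 - ‖x‖ ^ 2) ^ (-α)
  set w := (1 - ‖x‖ ^ 2) ^ α
  set w' := (1 - ‖x‖ ^ 2) ^ (α - 1)
  set e := MvPolynomial.eval (fun i => x i) E
  linear_combination -r * w * hid
    + (4 * c + N * (N + 2 * α + 3)) * MvPolynomial.eval (fun i => x i) F * hinv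
    - 2 * α * r * e * hw - 2 * α * r * w' * hEx - 2 * α * r * w' * e * hn

theorem jacobiPoly_radial_ode (k n : ℕ) (α : ℝ) (hα : -1 < α) :
    let J := (jacobiPoly k α (n + 1 / 2)).comp (Polynomial.X - 1)
    Polynomial.X * (1 - Polynomial.X) * Polynomial.derivative (Polynomial.derivative J)
      + (Polynomial.C ((n : ℝ) + 3 / 2) - Polynomial.C (α + n + 5 / 2) * Polynomial.X)
        * Polynomial.derivative J + Polynomial.C (k * (k + α + n + 3 / 2)) * J = 0 := by
  intro J
  have hn : (0 : ℝ) ≤ n := n.cast_nonneg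
  have h := congrArg (fun q => q.comp (Polynomial.X - 1))
    (jacobiPoly_ode k (α := α) (β := n + 1 / 2) hα (by linarith))
  simp only [Polynomial.add_comp, Polynomial.sub_comp, Polynomial.mul_comp, Polynomial.X_comp,
    Polynomial.C_comp, Polynomial.one_comp, Polynomial.zero_comp] at h
  have hdu : Polynomial.derivative (Polynomial.X - 1 : Polynomial ℝ) = 1 := by simp
  simp only [J, Polynomial.derivative_comp, hdu, one_mul]
  have e1 : (Polynomial.C (α + (n + 1 / 2) + 2) : Polynomial ℝ) = Polynomial.C (α + n + 5 / 2) := by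
    congr 1; ring
  have e2 : (Polynomial.C (k * (k + α + (n + 1 / 2) + 1)) : Polynomial ℝ)
      = Polynomial.C (k * (k + α + n + 3 / 2)) := by congr 1; ring
  have e3 : (Polynomial.C (α + n + 5 / 2) : Polynomial ℝ)
      = Polynomial.C (α + 1) + Polynomial.C ((n : ℝ) + 3 / 2) := by
    rw [← Polynomial.C_add]; congr 1; ring
  rw [e1, e2] at h
  linear_combination -h + (Polynomial.derivative (jacobiPoly k α (n + 1 / 2))).comp
    (Polynomial.X - 1) * (-e3)

theorem exists_ballB_eq_eval (α : ℝ) (k n l : ℕ) (hl1 : 1 ≤ l) (hl2 : l ≤ 2 * n + 1) :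
    ∃ P : MvPolynomial (Fin 3) ℝ,
      (MvPolynomial.X 0 * MvPolynomial.pderiv 0 P + MvPolynomial.X 1 * MvPolynomial.pderiv 1 P
        + MvPolynomial.X 2 * MvPolynomial.pderiv 2 P = MvPolynomial.C (n : ℝ) * P) ∧
      (MvPolynomial.pderiv 0 (MvPolynomial.pderiv 0 P)
        + MvPolynomial.pderiv 1 (MvPolynomial.pderiv 1 P)
        + MvPolynomial.pderiv 2 (MvPolynomial.pderiv 2 P) = 0) ∧
      ballB α k n l = fun y => MvPolynomial.eval (fun i => y i)
        (Polynomial.aeval radiusSq ((jacobiPoly k α (n + 1 / 2)).comp (Polynomial.X - 1)) * P) := by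
  obtain ⟨c, j, m, A, hjm, hA, hY⟩ := exists_solidY_eq_eval n l hl1 hl2
  have hom := hA.euler_mul m
  have lap := hA.laplace_mul m
  rw [hjm] at hom
  set S := A * gegenSolid j m
  set d := poch ((n : ℝ) + k + 3 / 2) k / poch ((n : ℝ) + k + α + 3 / 2) k
  refine ⟨MvPolynomial.C (d * c) * S, ?_, ?_, ?_⟩
  · simp only [MvPolynomial.pderiv_C_mul]
    linear_combination MvPolynomial.C (d * c) * hom
  · simp only [MvPolynomial.pderiv_C_mul]
    linear_combination MvPolynomial.C (d * c) * lap
  · funext y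
    have hJ : MvPolynomial.eval (fun i => y i) (Polynomial.aeval radiusSq
        ((jacobiPoly k α (n + 1 / 2)).comp (Polynomial.X - 1))) =
        jacobiP k α ((n : ℝ) + 1 / 2) (2 * ‖y‖ ^ 2 - 1) := by
      rw [jacobiP_eq_eval, Polynomial.aeval_def, Polynomial.hom_eval₂, eval_radiusSq]
      have : (MvPolynomial.eval fun i => y i).comp
          (algebraMap ℝ (MvPolynomial (Fin 3) ℝ)) = RingHom.id ℝ := by
        ext; simp
      rw [this, Polynomial.eval₂_id, Polynomial.eval_comp]
      congr 1
      simp; ring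
    rw [map_mul, hJ, map_mul, MvPolynomial.eval_C, ballB, hY]
    ring

/-- the ball polynomial `B_{k,l}^{α,n}` is an eigenfunction of the weighted
second-order operator `-(1-‖x‖²)^{-α} ∇·[(I - x xᵀ)(1-‖x‖²)^α ∇·]` with eigenvalue
`(n+2k)(n+2k+2α+3)`.  Here `(I - x xᵀ) v = v - ⟪x, v⟫ x`, and the divergence is written
as the sum of the partial derivatives of the components of the vector field. -/
theorem ball_polynomial_eigenfunction (α : ℝ) (hα : -1 < α) (k n l : ℕ)
    (hl1 : 1 ≤ l) (hl2 : l ≤ 2 * n + 1) (x : E3) (hx : ‖x‖ < 1) :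
    -((1 - ‖x‖ ^ 2) ^ (-α)) *
        (∑ i : Fin 3,
          fderiv ℝ (fun y : E3 =>
              ((1 - ‖y‖ ^ 2) ^ α) •
                (gradient (ballB α k n l) y - ⟪y, gradient (ballB α k n l) y⟫ • y))
            x (EuclideanSpace.single i 1) i) =
      ((n : ℝ) + 2 * k) * ((n : ℝ) + 2 * k + 2 * α + 3) * ballB α k n l x := by
  obtain ⟨P, hom, lap, hB⟩ := exists_ballB_eq_eval α k n l hl1 hl2
  rw [weighted_divergence_eval α n (k * (k + α + n + 3 / 2)) P _ hom lap (jacobiPoly_radial_ode k n α hα) _ hB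
    x hx]
  ring
end
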